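/- For every weight w, the denominators of the Fourier coefficients of the normalized extremal quasimodular forms of weight w and depth r, for every depth r ≤ 4, are divisible only by primes p < w; that is, each Fourier coefficient is a rational number whose denominator (in lowest terms) has no prime factor ≥ w. -/

import Mathlib

open Complex UpperHalfPlane Finset
open scoped Manifold MatrixGroups Real

noncomputable section

/-- The nome `q = e^{2πiz}`. -/
def qexp (z : ℍ) : ℂ := Complex.exp (2 * Real.pi * Complex.I * z)

/-- The normalized Eisenstein series `E_k` (for even `k ≥ 2`), defined via its
`q`-expansion `E_k = 1 - (2k/B_k) ∑_{n ≥ 1} σ_{k-1}(n) q^n`. -/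
def Eis (k : ℕ) (z : ℍ) : ℂ :=
  1 - (2 * k / ((bernoulli k : ℚ) : ℂ)) *
    ∑' n : ℕ, (ArithmeticFunction.sigma (k - 1) (n + 1) : ℂ) * qexp z ^ (n + 1)

/-- The modular discriminant `Δ = (E_4³ − E_6²)/1728`. -/
def Disc (z : ℍ) : ℂ := (Eis 4 z ^ 3 - Eis 6 z ^ 2) / 1728

/-- The space of holomorphic modular forms of weight `w` for the full modular group,
as a set of functions on `ℍ`. -/
def Mset (w : ℤ) : Set (ℍ → ℂ) :=
  {f | ∃ F : ModularForm (⊤ : Subgroup SL(2, ℤ)) w, ⇑F = f}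

/-- The set of quasimodular forms of weight `w` and depth `≤ r`:
functions of the form `∑_{ℓ=0}^r E_2^ℓ h_ℓ` with `h_ℓ ∈ M_{w-2ℓ}`. -/
def QMset (w : ℤ) (r : ℕ) : Set (ℍ → ℂ) :=
  {f | ∃ h : ℕ → ℍ → ℂ, (∀ ℓ ≤ r, h ℓ ∈ Mset (w - 2 * ℓ)) ∧
        ∀ z, f z = ∑ ℓ ∈ Finset.range (r + 1), Eis 2 z ^ ℓ * h ℓ z}

/-- `QM_w^r` as a `ℂ`-subspace of the functions on `ℍ`. -/
def QM (w : ℤ) (r : ℕ) : Submodule ℂ (ℍ → ℂ) := Submodule.span ℂ (QMset w r)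

/-- `dim QM_w^r`. -/
def dimQM (w : ℤ) (r : ℕ) : ℕ := Module.finrank ℂ (QM w r)

/-- The complex derivative of a function on `ℍ` (via an extension to `ℂ`; since `ℍ` is
open in `ℂ` this agrees with the complex derivative for holomorphic `f`). -/
def hderiv (f : ℍ → ℂ) (z : ℍ) : ℂ :=
  deriv (fun w : ℂ => if h : 0 < w.im then f ⟨w, h⟩ else 0) z

/-- The normalized derivative `f' = (2πi)⁻¹ df/dz = q df/dq`. -/
def qderiv (f : ℍ → ℂ) (z : ℍ) : ℂ := (2 * Real.pi * Complex.I)⁻¹ * hderiv f z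

/-- The Serre derivative `∂_w f = f' - (w/12) E_2 f`. -/
def serre (w : ℤ) (f : ℍ → ℂ) (z : ℍ) : ℂ :=
  qderiv f z - ((w : ℂ) / 12) * Eis 2 z * f z

/-- Iterated Serre derivatives: `∂_w^0 f = f`, `∂_w^{k+1} f = ∂_{w+2k}(∂_w^k f)`. -/
def serreIter (w : ℤ) : ℕ → (ℍ → ℂ) → (ℍ → ℂ)
  | 0, f => f
  | (k + 1), f => serre (w + 2 * k) (serreIter w k f)

/-- `z ↦ -1/z` as a map `ℍ → ℍ`. -/
def Sact (z : ℍ) : ℍ :=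
  ⟨-(z : ℂ)⁻¹, by
    have h0 : (z : ℂ) ≠ 0 := z.ne_zero
    have : (-(z : ℂ)⁻¹).im = (z : ℂ).im / Complex.normSq (z : ℂ) := by
      rw [Complex.neg_im, Complex.inv_im]; ring
    rw [this]
    exact div_pos z.im_pos (Complex.normSq_pos.mpr h0)⟩

/-- `z ↦ z + 1` as a map `ℍ → ℍ`. -/
def Tact (z : ℍ) : ℍ := ⟨(z : ℂ) + 1, by simpa using z.im_pos⟩

/-- `g` has a `q`-expansion with vanishing order exactly `ν` at `i∞`:
`g = q^ν ∑_{n≥0} a(n) qⁿ` with `a(0) ≠ 0`. -/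
def HasQExpansionAt (g : ℍ → ℂ) (ν : ℕ) : Prop :=
  ∃ a : ℕ → ℂ, a 0 ≠ 0 ∧ ∀ z : ℍ, HasSum (fun n : ℕ => a n * qexp z ^ (ν + n)) (g z)

/-- The quasimodular forms `g_ℓ` attached to `f = ∑_{ℓ=0}^r E_2^ℓ h_ℓ`, defined by
`C(r,ℓ) g_ℓ = (6/(πi))^ℓ ∑_{m=0}^{r-ℓ} C(ℓ+m,m) E_2^m h_{ℓ+m}`. -/
def gOf (r : ℕ) (h : ℕ → ℍ → ℂ) (ℓ : ℕ) (z : ℍ) : ℂ :=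
  ((r.choose ℓ : ℂ))⁻¹ * (6 / ((Real.pi : ℂ) * Complex.I)) ^ ℓ *
    ∑ m ∈ Finset.range (r - ℓ + 1), (((ℓ + m).choose m : ℕ) : ℂ) * Eis 2 z ^ m * h (ℓ + m) z

/-- `f` is a balanced quasimodular form of weight `w` and depth `r`. -/
def IsBalancedQM (w : ℤ) (r : ℕ) (f : ℍ → ℂ) : Prop :=
  ∃ h : ℕ → ℍ → ℂ, ∃ lam : ℕ → ℕ,
    (∀ ℓ ≤ r, h ℓ ∈ Mset (w - 2 * ℓ)) ∧ h r ≠ 0 ∧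
    (∀ z, f z = ∑ ℓ ∈ Finset.range (r + 1), Eis 2 z ^ ℓ * h ℓ z) ∧
    (∀ ℓ ≤ r, HasQExpansionAt (gOf r h ℓ) (lam ℓ)) ∧
    (∀ i j, i ≤ j → j ≤ r → lam j ≤ lam i) ∧
    (∀ ℓ ≤ r, lam ℓ < dimQM (w - 2 * ℓ) (r - ℓ)) ∧
    (∑ ℓ ∈ Finset.range (r + 1), lam ℓ) = dimQM w r - 1

/-- `f` is the normalized extremal quasimodular form of weight `w` and depth `r`:
`f ∈ QM_w^r` with `q`-expansion `q^{dim QM_w^r - 1}(1 + O(q))`. -/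
def IsNormalizedExtremalQM (w : ℤ) (r : ℕ) (f : ℍ → ℂ) : Prop :=
  f ∈ QM w r ∧ ∃ a : ℕ → ℂ, a 0 = 1 ∧
    ∀ z : ℍ, HasSum (fun n : ℕ => a n * qexp z ^ (dimQM w r - 1 + n)) (f z)

/-- `f 0, …, f (n-1)` is a fundamental system of solutions of the linear differential
equation `K g = 0`: holomorphic linearly independent solutions spanning all
holomorphic solutions. -/
def IsFundamentalSystem {n : ℕ} (K : (ℍ → ℂ) → (ℍ → ℂ)) (f : Fin n → ℍ → ℂ) : Prop :=
  (∀ i, MDifferentiable 𝓘(ℂ) 𝓘(ℂ) (f i)) ∧ (∀ i, K (f i) = 0) ∧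
    LinearIndependent ℂ f ∧
    ∀ g : ℍ → ℂ, MDifferentiable 𝓘(ℂ) 𝓘(ℂ) g → K g = 0 → g ∈ Submodule.span ℂ (Set.range f)


/-- `F = (f_0, …, f_r)ᵀ` is a quasimodular vector of weight `w` and dimension `r+1`:
all components are holomorphic and there is a quasimodular form `f = ∑_{ℓ=0}^s E_2^ℓ h_ℓ`
of weight `w` and depth `s ≤ r` such that
`f_k(z) = ∑_{ℓ=0}^{min(k,s)} C(k,ℓ) z^{k-ℓ} g_ℓ(z)` for the attached forms `g_ℓ`. -/
def IsQuasimodularVector (w : ℤ) (r : ℕ) (F : Fin (r + 1) → ℍ → ℂ) : Prop :=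
  (∀ k, MDifferentiable 𝓘(ℂ) 𝓘(ℂ) (F k)) ∧
  ∃ s : ℕ, s ≤ r ∧ ∃ h : ℕ → ℍ → ℂ,
    (∀ ℓ ≤ s, h ℓ ∈ Mset (w - 2 * ℓ)) ∧ (s = 0 ∨ h s ≠ 0) ∧
    ∀ (k : Fin (r + 1)) (z : ℍ),
      F k z = ∑ ℓ ∈ Finset.range (min (k : ℕ) s + 1),
        (((k : ℕ).choose ℓ : ℕ) : ℂ) * (z : ℂ) ^ ((k : ℕ) - ℓ) * gOf s h ℓ z

/-- The modular Wronskian `W(z) = det(F, ∂_{w-r}F, …, ∂_{w-r}^r F)`. -/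
def modularWronskian (w : ℤ) (r : ℕ) (F : Fin (r + 1) → ℍ → ℂ) (z : ℍ) : ℂ :=
  Matrix.det (Matrix.of fun (k j : Fin (r + 1)) => serreIter (w - r) (j : ℕ) (F k) z)

end

namespace ExtremalQM

noncomputable section

open Polynomial
open scoped PowerSeries Matrix

section Coeffwise

variable {k R : Type*} [CommRing k] [CommRing R] [Algebra k R]

/-- A derivation applied to every coefficient of a polynomial. -/
def coeffwise (d : Derivation k R R) (f : R[X]) : R[X] :=
  ∑ i ∈ range (f.natDegree + 1), monomial i (d (f.coeff i))

@[simp] lemma coeff_coeffwise (d : Derivation k R R) (f : R[X]) (n : ℕ) :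
    (coeffwise d f).coeff n = d (f.coeff n) := by
  simp only [coeffwise, finsetSum_coeff, coeff_monomial, Finset.sum_ite_eq', Finset.mem_range]
  split_ifs with h
  · rfl
  · rw [coeff_eq_zero_of_natDegree_lt (by omega), map_zero]

lemma coeffwise_add (d : Derivation k R R) (f g : R[X]) :
    coeffwise d (f + g) = coeffwise d f + coeffwise d g := by
  ext n; simp

lemma coeffwise_mul (d : Derivation k R R) (f g : R[X]) :
    coeffwise d (f * g) = coeffwise d f * g + f * coeffwise d g := by
  ext n
  simp only [coeff_coeffwise, coeff_mul, coeff_add, map_sum, Derivation.leibniz, smul_eq_mul]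
  rw [← Finset.sum_add_distrib]
  refine Finset.sum_congr rfl fun x _ => by ring

@[simp] lemma coeffwise_C (d : Derivation k R R) (a : R) : coeffwise d (C a) = C (d a) := by
  ext n; rw [coeff_coeffwise, coeff_C, coeff_C]; split_ifs <;> simp

@[simp] lemma coeffwise_X_pow (d : Derivation k R R) (n : ℕ) :
    coeffwise d (X ^ n : R[X]) = 0 := by
  ext m; rw [coeff_coeffwise, coeff_X_pow]; split_ifs <;> simp

lemma coeffwise_C_mul_X_pow (d : Derivation k R R) (a : R) (n : ℕ) :
    coeffwise d (C a * X ^ n) = C (d a) * X ^ n := by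
  rw [coeffwise_mul]; simp

end Coeffwise

/-- A grading of a commutative ring by natural numbers, encoded as the ring homomorphism that
multiplies the part of degree `n` by the `n`-th power of a new variable. -/
structure Grading (A : Type*) [CommRing A] where
  /-- The homomorphism `a ↦ ∑ aₙ Tⁿ`. -/
  hom : A →+* A[X]
  coassoc : ∀ a n, hom ((hom a).coeff n) = C ((hom a).coeff n) * X ^ n
  counit : ∀ a, (hom a).eval 1 = a

namespace Grading

variable {A : Type*} [CommRing A] (G : Grading A)

/-- The element `a` is homogeneous of degree `n`. -/
def Hom (n : ℕ) (a : A) : Prop := G.hom a = C a * X ^ n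

variable {G}

lemma Hom.zero (n : ℕ) : G.Hom n 0 := by simp [Hom]

lemma Hom.add {n : ℕ} {a b : A} (ha : G.Hom n a) (hb : G.Hom n b) : G.Hom n (a + b) := by
  unfold Hom at *; rw [map_add, ha, hb, C_add]; ring

lemma Hom.sub {n : ℕ} {a b : A} (ha : G.Hom n a) (hb : G.Hom n b) : G.Hom n (a - b) := by
  unfold Hom at *; rw [map_sub, ha, hb, C_sub]; ring

lemma Hom.mul {m n : ℕ} {a b : A} (ha : G.Hom m a) (hb : G.Hom n b) :
    G.Hom (m + n) (a * b) := by
  unfold Hom at *; rw [map_mul, ha, hb, C_mul]; ring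

lemma Hom.pow {m : ℕ} {a : A} (ha : G.Hom m a) (n : ℕ) : G.Hom (n * m) (a ^ n) := by
  unfold Hom at *; rw [map_pow, ha, C_pow, mul_pow, ← pow_mul, mul_comm m n]

lemma hom_injective : Function.Injective G.hom := fun a b h => by
  rw [← G.counit a, ← G.counit b, h]

lemma hom_component (a : A) (n : ℕ) : G.Hom n ((G.hom a).coeff n) := G.coassoc a n

lemma le_and_hom_of_mul_X_pow {m n : ℕ} {b : A} (hb : b ≠ 0)
    (h : X ^ m * G.hom b = C b * X ^ n) : m ≤ n ∧ G.Hom (n - m) b := by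
  have hmn : m ≤ n := by
    by_contra hlt
    have := congrArg (fun f => Polynomial.coeff f n) h
    simp only [coeff_X_pow_mul', coeff_C_mul, coeff_X_pow, if_true, mul_one,
      if_neg hlt] at this
    exact hb this.symm
  refine ⟨hmn, ?_⟩
  ext i
  have := congrArg (fun f => Polynomial.coeff f (i + m)) h
  rw [show n = (n - m) + m by omega, pow_add, ← mul_assoc] at this
  simpa only [coeff_X_pow_mul, coeff_mul_X_pow] using this

/-- The cofactor of a homogeneous element in a homogeneous element is homogeneous. -/
lemma Hom.of_mul [IsDomain A] {m n : ℕ} {a b : A} (ha : G.Hom m a) (hab : G.Hom n (a * b))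
    (ha0 : a ≠ 0) (hb0 : b ≠ 0) : m ≤ n ∧ G.Hom (n - m) b := by
  apply le_and_hom_of_mul_X_pow hb0
  have h : C a * (X ^ m * G.hom b) = C a * (C b * X ^ n) := by
    unfold Hom at ha hab
    rw [map_mul, ha, C_mul] at hab
    linear_combination hab
  exact mul_left_cancel₀ (by simpa using ha0) h

variable (G) in
/-- The Euler operator: multiplication by `n` on the part of degree `n`. -/
def euler (a : A) : A := (derivative (G.hom a)).eval 1

lemma euler_add (a b : A) : G.euler (a + b) = G.euler a + G.euler b := by simp [euler]

lemma euler_mul (a b : A) : G.euler (a * b) = G.euler a * b + a * G.euler b := by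
  simp [euler, G.counit]

lemma Hom.euler {n : ℕ} {a : A} (h : G.Hom n a) : G.euler a = n * a := by
  unfold Grading.euler; rw [h]; simp [derivative_X_pow]; ring

end Grading

section Standard

variable {k : Type*} [Field k] {σ : Type*}

/-- The homomorphism defining the grading of `MvPolynomial σ k` with weights `wt`. -/
def weightHom (k : Type*) [Field k] (wt : σ → ℕ) :
    MvPolynomial σ k →+* (MvPolynomial σ k)[X] :=
  MvPolynomial.eval₂Hom (C.comp MvPolynomial.C) fun i => C (MvPolynomial.X i) * X ^ wt i

lemma weightHom_monomial (wt : σ → ℕ) (d : σ →₀ ℕ) (c : k) :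
    weightHom k wt (MvPolynomial.monomial d c) =
      C (MvPolynomial.monomial d c) * X ^ (d.sum fun i m => m * wt i) := by
  rw [weightHom, MvPolynomial.coe_eval₂Hom, MvPolynomial.eval₂_monomial, MvPolynomial.monomial_eq]
  simp only [Finsupp.prod, Finsupp.sum, mul_pow, Finset.prod_mul_distrib, C_mul, map_prod, C_pow,
    ← pow_mul, Finset.prod_pow_eq_pow_sum, RingHom.comp_apply, mul_comm (wt _)]
  ring

/-- The grading of `MvPolynomial σ k` with weights `wt`. -/
def mvGrading (k : Type*) [Field k] (wt : σ → ℕ) : Grading (MvPolynomial σ k) where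
  hom := weightHom k wt
  coassoc a n := by
    induction a using MvPolynomial.induction_on' with
    | monomial d c =>
      rw [weightHom_monomial, coeff_C_mul, coeff_X_pow]
      split_ifs with h
      · rw [mul_one, weightHom_monomial, h]
      · simp
    | add p q hp hq => simp only [map_add, coeff_add, hp, hq, add_mul]
  counit a := by
    induction a using MvPolynomial.induction_on' with
    | monomial d c => simp [weightHom_monomial]
    | add p q hp hq => simp only [map_add, eval_add, hp, hq]

lemma coeff_coeff_weightHom (wt : σ → ℕ) (f : MvPolynomial σ k) (d : σ →₀ ℕ) (n : ℕ) :
    ((weightHom k wt f).coeff n).coeff d =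
      if n = d.sum (fun i m => m * wt i) then f.coeff d else 0 := by
  classical
  induction f using MvPolynomial.induction_on' with
  | monomial e c =>
    rw [weightHom_monomial, coeff_C_mul, coeff_X_pow]
    by_cases hed : e = d
    · subst hed; split_ifs <;> simp
    · split_ifs <;> simp [MvPolynomial.coeff_monomial, hed]
  | add p q hp hq => simp only [map_add, coeff_add, MvPolynomial.coeff_add, hp, hq]; split_ifs <;> simp

lemma weight_of_mem_support {wt : σ → ℕ} {f : MvPolynomial σ k} {n : ℕ}
    (hf : (mvGrading k wt).Hom n f) {d : σ →₀ ℕ} (hd : f.coeff d ≠ 0) :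
    d.sum (fun i m => m * wt i) = n := by
  have h : weightHom k wt f = C f * X ^ n := hf
  have := coeff_coeff_weightHom wt f d n
  rw [h, coeff_C_mul, coeff_X_pow, if_pos rfl, mul_one] at this
  by_contra hne
  rw [if_neg (Ne.symm hne)] at this
  exact hd this

end Standard

/-- The polynomial ring in two variables, standing for `E₄` and `E₆`. -/
abbrev ModRing (k : Type*) [Field k] := MvPolynomial (Fin 2) k

/-- The polynomial ring over `ModRing k` in one variable, standing for `E₂`. -/
abbrev QModRing (k : Type*) [Field k] := (ModRing k)[X]

section Algebra

variable {k : Type*} [Field k]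

/-- The grading of `ModRing k` by the weights 4 and 6. -/
def grB (k : Type*) [Field k] : Grading (ModRing k) := mvGrading k ![4, 6]

/-- The variable standing for `E₄`. -/
def vQ (k : Type*) [Field k] : ModRing k := MvPolynomial.X 0

/-- The variable standing for `E₆`. -/
def vR (k : Type*) [Field k] : ModRing k := MvPolynomial.X 1

lemma grB_vQ : (grB k).Hom 4 (vQ k) := by
  simp [grB, mvGrading, Grading.Hom, weightHom, vQ]

lemma grB_vR : (grB k).Hom 6 (vR k) := by
  simp [grB, mvGrading, Grading.Hom, weightHom, vR]

lemma grB_C (c : k) : (grB k).Hom 0 (MvPolynomial.C c) := by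
  simp [grB, mvGrading, Grading.Hom, weightHom]

lemma modRing_induction {motive : ModRing k → Prop} (f : ModRing k)
    (hC : ∀ c, motive (MvPolynomial.C c)) (hadd : ∀ f g, motive f → motive g → motive (f + g))
    (hQ : ∀ f, motive f → motive (f * vQ k)) (hR : ∀ f, motive f → motive (f * vR k)) :
    motive f := by
  induction f using MvPolynomial.induction_on with
  | C c => exact hC c
  | add f g hf hg => exact hadd f g hf hg
  | mul_X f i hf => fin_cases i; exacts [hQ f hf, hR f hf]

/-- The homomorphism defining the grading of `QModRing k`, the new variable having weight 2. -/
def homA (k : Type*) [Field k] : QModRing k →+* (QModRing k)[X] :=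
  eval₂RingHom ((mapRingHom C).comp (grB k).hom) (C X * X ^ 2)

lemma homA_C_mul_X_pow (b : ModRing k) (l : ℕ) :
    homA k (C b * X ^ l) = ((grB k).hom b).map C * (C (X ^ l) * X ^ (2 * l)) := by
  simp [homA, mul_pow, pow_mul]

lemma coeff_coeff_homA (f : QModRing k) (m l : ℕ) :
    ((homA k f).coeff m).coeff l = (X ^ (2 * l) * (grB k).hom (f.coeff l)).coeff m := by
  induction f using Polynomial.induction_on' with
  | add f g hf hg => simp only [map_add, coeff_add, hf, hg, mul_add]
  | monomial i b =>
    rw [← C_mul_X_pow_eq_monomial, homA_C_mul_X_pow, mul_left_comm, coeff_C_mul,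
      coeff_mul_X_pow', coeff_map, coeff_C_mul_X_pow, coeff_X_pow_mul']
    by_cases h : l = i
    · subst h
      rw [if_pos le_rfl, if_pos rfl, Nat.sub_self, coeff_X_pow_mul']
      split_ifs <;> simp
    · rw [if_neg h, map_zero, mul_zero, coeff_zero]
      split_ifs
      · rw [coeff_C, if_neg (by omega)]
      · rw [coeff_zero]
      · rfl

/-- The grading of `QModRing k`. -/
def grA (k : Type*) [Field k] : Grading (QModRing k) where
  hom := homA k
  coassoc a n := by
    ext m l : 2
    rw [coeff_coeff_homA, coeff_coeff_homA, coeff_C_mul, coeff_X_pow, coeff_X_pow_mul',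
      coeff_X_pow_mul']
    by_cases h : 2 * l ≤ n
    · rw [if_pos h, (grB k).coassoc, coeff_C_mul, coeff_X_pow]
      by_cases hm : m = n
      · subst hm; rw [if_pos h, if_pos rfl, if_pos rfl, mul_one, mul_one, coeff_coeff_homA,
          coeff_X_pow_mul', if_pos h]
      · rw [if_neg hm, mul_zero, coeff_zero]
        split_ifs with h1 h2
        · omega
        · simp
        · rfl
    · rw [if_neg h, map_zero, coeff_zero]
      by_cases hm : m = n
      · subst hm; rw [if_neg h, if_pos rfl, mul_one, coeff_coeff_homA, coeff_X_pow_mul', if_neg h]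
      · simp [hm]
  counit a := by
    induction a using Polynomial.induction_on' with
    | add f g hf hg => simp only [map_add, eval_add, hf, hg]
    | monomial i b =>
      rw [← C_mul_X_pow_eq_monomial, homA_C_mul_X_pow]
      have : eval 1 (((grB k).hom b).map C) = (C b : QModRing k) := by
        rw [← C_1, eval_map, eval₂_hom, (grB k).counit]
      simp [this]

lemma grA_hom_iff {f : QModRing k} {n : ℕ} : (grA k).Hom n f ↔
    ∀ l, X ^ (2 * l) * (grB k).hom (f.coeff l) = C (f.coeff l) * X ^ n := by
  have key : ∀ l m, (((C f * X ^ n : (QModRing k)[X])).coeff m).coeff l =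
      ((C (f.coeff l) * X ^ n : (ModRing k)[X])).coeff m := by
    intro l m
    rw [coeff_C_mul, coeff_C_mul, coeff_X_pow, coeff_X_pow]
    split_ifs <;> simp
  constructor
  · intro h l
    ext m : 1
    rw [← coeff_coeff_homA, ← key]
    exact congrArg (fun g : (QModRing k)[X] => (g.coeff m).coeff l) h
  · intro h
    refine Polynomial.ext fun m => Polynomial.ext fun l => ?_
    rw [key, ← h l]
    exact coeff_coeff_homA f m l

lemma Hom_C {b : ModRing k} {n : ℕ} (hb : (grB k).Hom n b) : (grA k).Hom n (C b) := by
  have := homA_C_mul_X_pow b 0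
  simp only [pow_zero, mul_one, mul_zero, C_1] at this
  unfold Grading.Hom at *
  change homA k _ = _
  rw [this, hb]
  simp

lemma Hom_X : (grA k).Hom 2 (X : QModRing k) := by
  change homA k _ = _
  simp [homA]

lemma Hom.coeff {f : QModRing k} {n : ℕ} (hf : (grA k).Hom n f) (l : ℕ) :
    f.coeff l = 0 ∨ (2 * l ≤ n ∧ (grB k).Hom (n - 2 * l) (f.coeff l)) := by
  by_cases h : f.coeff l = 0
  · exact Or.inl h
  · exact Or.inr (Grading.le_and_hom_of_mul_X_pow h (grA_hom_iff.1 hf l))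

/-- The derivation of `ModRing k` given by `E₄ ↦ -E₆/3`, `E₆ ↦ -E₄²/2`. -/
def serreB (k : Type*) [Field k] : Derivation k (ModRing k) (ModRing k) :=
  MvPolynomial.mkDerivation k
    ![MvPolynomial.C (-(1 / 3 : k)) * vR k, MvPolynomial.C (-(1 / 2 : k)) * vQ k ^ 2]

lemma serreB_vQ : serreB k (vQ k) = MvPolynomial.C (-(1 / 3 : k)) * vR k := by
  simp [serreB, vQ, MvPolynomial.mkDerivation_X]

lemma serreB_vR : serreB k (vR k) = MvPolynomial.C (-(1 / 2 : k)) * vQ k ^ 2 := by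
  simp [serreB, vR, MvPolynomial.mkDerivation_X]

lemma serreB_C (c : k) : serreB k (MvPolynomial.C c) = 0 := by
  simp [serreB]

lemma grB_hom_serreB (b : ModRing k) :
    (grB k).hom (serreB k b) = X ^ 2 * coeffwise (serreB k) ((grB k).hom b) := by
  induction b using modRing_induction with
  | hC c =>
    have h : (grB k).hom (MvPolynomial.C c) = C (MvPolynomial.C c) :=
      (grB_C c).trans (by rw [pow_zero, mul_one])
    rw [serreB_C, h, coeffwise_C, serreB_C]; simp
  | hadd f g hf hg => simp only [map_add, coeffwise_add, hf, hg, mul_add]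
  | hQ f hf =>
    have hc := grB_C (-(1 / 3 : k))
    have hQ : (grB k).hom (vQ k) = C (vQ k) * X ^ 4 := grB_vQ
    have hQ' : (grB k).hom (serreB k (vQ k)) = C (serreB k (vQ k)) * X ^ 6 := by
      rw [serreB_vQ]; exact (hc.mul grB_vR).trans (by rw [zero_add])
    rw [Derivation.leibniz, map_add, smul_eq_mul, smul_eq_mul, map_mul, map_mul, hf, map_mul,
      coeffwise_mul, hQ', hQ, coeffwise_C_mul_X_pow]
    ring
  | hR f hf =>
    have hc := grB_C (-(1 / 2 : k))
    have hR : (grB k).hom (vR k) = C (vR k) * X ^ 6 := grB_vR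
    have hR' : (grB k).hom (serreB k (vR k)) = C (serreB k (vR k)) * X ^ 8 := by
      rw [serreB_vR]; exact (hc.mul (grB_vQ.pow 2)).trans (by rw [zero_add])
    rw [Derivation.leibniz, map_add, smul_eq_mul, smul_eq_mul, map_mul, map_mul, hf, map_mul,
      coeffwise_mul, hR', hR, coeffwise_C_mul_X_pow]
    ring

lemma grA_hom_coeffwise_serreB {f : QModRing k} {n : ℕ} (hf : (grA k).Hom n f) :
    (grA k).Hom (n + 2) (coeffwise (serreB k) f) := by
  rw [grA_hom_iff] at *
  intro l
  rw [coeff_coeffwise, grB_hom_serreB]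
  have := congrArg (coeffwise (serreB k)) (hf l)
  rw [coeffwise_mul, coeffwise_X_pow, coeffwise_C_mul_X_pow] at this
  linear_combination X ^ 2 * this

lemma grA_hom_mul_derivative {f : QModRing k} {n : ℕ} (hf : (grA k).Hom n f) {h : QModRing k}
    (hh : (grA k).Hom 4 h) : (grA k).Hom (n + 2) (h * derivative f) := by
  have hd : (homA k (derivative f)) * X ^ 2 = C (derivative f) * X ^ n := by
    refine Polynomial.ext fun m => Polynomial.ext fun l => ?_
    have h1 := grA_hom_iff.1 hf (l + 1)
    have h2 : X ^ (2 * l) * (grB k).hom ((derivative f).coeff l) * X ^ 2 =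
        C ((derivative f).coeff l) * X ^ n := by
      rw [coeff_derivative, map_mul, C_mul]
      have : (grB k).hom ((l : ModRing k) + 1) = C ((l : ModRing k) + 1) := by simp
      rw [this]
      linear_combination C ((l : ModRing k) + 1) * h1
    have h3 := congrArg (fun g => Polynomial.coeff g m) h2
    rw [coeff_C_mul, coeff_X_pow, coeff_mul_X_pow'] at h3
    rw [coeff_C_mul, coeff_X_pow, coeff_mul_X_pow']
    rw [apply_ite (fun g => coeff g l), coeff_coeff_homA, coeff_zero, h3]
    split_ifs <;> simp
  have hh' : homA k h = C h * X ^ 4 := hh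
  change homA k _ = _
  rw [map_mul, hh', C_mul]
  calc C h * X ^ 4 * homA k (derivative f)
      = C h * X ^ 2 * (homA k (derivative f) * X ^ 2) := by ring
    _ = C h * C (derivative f) * X ^ (n + 2) := by rw [hd]; ring

/-- The derivation `θ` on `QModRing k`, restricted to weight `n`. -/
def dop (n : k) (f : QModRing k) : QModRing k :=
  coeffwise (serreB k) f + C (MvPolynomial.C (n / 12)) * X * f
    - C (MvPolynomial.C (1 / 12)) * (X ^ 2 + C (vQ k)) * derivative f

lemma grA_C_C (c : k) : (grA k).Hom 0 (C (MvPolynomial.C c)) := Hom_C (grB_C c)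

lemma Hom.dop {f : QModRing k} {n : ℕ} (c : k) (hf : (grA k).Hom n f) :
    (grA k).Hom (n + 2) (dop c f) := by
  refine ((grA_hom_coeffwise_serreB hf).add ?_).sub ?_
  · have := ((grA_C_C (c / 12)).mul Hom_X).mul hf
    rwa [zero_add, add_comm] at this
  · refine grA_hom_mul_derivative hf ?_
    have := (grA_C_C (1 / 12 : k)).mul ((Hom_X.pow 2).add (Hom_C grB_vQ))
    rwa [zero_add] at this

end Algebra

/-- The derivation `θ = X d/dX` of power series. -/
def theta (k : Type*) [CommRing k] : Derivation k k⟦X⟧ k⟦X⟧ :=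
  (PowerSeries.X : k⟦X⟧) • PowerSeries.derivative k

lemma coeff_theta {k : Type*} [CommRing k] (f : k⟦X⟧) (n : ℕ) :
    PowerSeries.coeff n (theta k f) = n * PowerSeries.coeff n f := by
  rw [theta, Derivation.smul_apply, smul_eq_mul]
  cases n with
  | zero => simp
  | succ n => rw [PowerSeries.coeff_succ_X_mul, PowerSeries.coeff_derivative]; push_cast; ring

/-- Three power series satisfying Ramanujan's differential equations, with the normalisation of
the Eisenstein series `E₂`, `E₄`, `E₆`. -/
structure RamanujanTriple (k : Type*) [Field k] where
  (P Q R : k⟦X⟧)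
  constP : PowerSeries.constantCoeff P = 1
  constQ : PowerSeries.constantCoeff Q = 1
  constR : PowerSeries.constantCoeff R = 1
  thetaP : 12 * theta k P = P ^ 2 - Q
  thetaQ : 3 * theta k Q = P * Q - R
  thetaR : 2 * theta k R = P * R - Q ^ 2
  six_ne : (6 : k) ≠ 0
  disc_ne : PowerSeries.coeff 1 (Q ^ 3 - R ^ 2) ≠ 0

namespace RamanujanTriple

variable {k : Type*} [Field k] (t : RamanujanTriple k)

/-- Substitution of the series in an element of `ModRing k`. -/
def evB : ModRing k →+* k⟦X⟧ := MvPolynomial.eval₂Hom PowerSeries.C ![t.Q, t.R]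

@[simp] lemma evB_vQ : t.evB (vQ k) = t.Q := by simp [evB, vQ]

@[simp] lemma evB_vR : t.evB (vR k) = t.R := by simp [evB, vR]

@[simp] lemma evB_C (c : k) : t.evB (MvPolynomial.C c) = PowerSeries.C c := by simp [evB]

/-- Substitution of the series in an element of `QModRing k`. -/
def evA : QModRing k →+* k⟦X⟧ := eval₂RingHom t.evB t.P

/-- Substitution of the series `P + Y`, `Q`, `R` in an element of `QModRing k`. -/
def shift : QModRing k →+* k⟦X⟧[X] := eval₂RingHom (C.comp t.evB) (X + C t.P)

@[simp] lemma shift_C (b : ModRing k) : t.shift (C b) = C (t.evB b) := by simp [shift]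

@[simp] lemma shift_X : t.shift X = X + C t.P := by simp [shift]

lemma coeff_zero_shift (f : QModRing k) : (t.shift f).coeff 0 = t.evA f := by
  induction f using Polynomial.induction_on' with
  | add f g hf hg => simp only [map_add, coeff_add, hf, hg]
  | monomial i b =>
    rw [← C_mul_X_pow_eq_monomial, map_mul, map_mul, map_pow, map_pow, shift_C, shift_X,
      coeff_zero_eq_eval_zero]
    simp [evA]

lemma twelve_ne (t : RamanujanTriple k) : (12 : k) ≠ 0 := by
  have h := t.six_ne
  intro h12
  have h2 : (2 : k) = 0 ∨ (6 : k) = 0 := by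
    rw [← mul_eq_zero]; rw [← h12]; norm_num
  rcases h2 with h2 | h2
  · apply h
    rw [show (6 : k) = 2 * 3 by norm_num, h2, zero_mul]
  · exact h h2

lemma three_ne (t : RamanujanTriple k) : (3 : k) ≠ 0 := by
  have h := t.six_ne
  intro h2
  rw [show (6 : k) = 2 * 3 by norm_num, h2, mul_zero] at h
  exact h rfl

lemma two_ne (t : RamanujanTriple k) : (2 : k) ≠ 0 := by
  have h := t.six_ne
  intro h2
  rw [show (6 : k) = 2 * 3 by norm_num, h2, zero_mul] at h
  exact h rfl

lemma C_inv_twelve (t : RamanujanTriple k) : (PowerSeries.C (1 / 12 : k)) * 12 = 1 := by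
  rw [show (12 : k⟦X⟧) = PowerSeries.C 12 from (map_ofNat PowerSeries.C 12).symm, ← map_mul, one_div, inv_mul_cancel₀ t.twelve_ne,
    map_one]

lemma theta_P_eq : theta k t.P = PowerSeries.C (1 / 12 : k) * (t.P ^ 2 - t.Q) := by
  rw [← t.thetaP]
  linear_combination -(theta k t.P) * t.C_inv_twelve

lemma evB_serreB_vQ : t.evB (serreB k (vQ k)) =
    theta k t.Q - PowerSeries.C (1 / 12 : k) * t.P * (4 * t.Q) := by
  have h3 : (PowerSeries.C (1 / 12 : k)) * 4 * 3 = 1 := by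
    rw [← t.C_inv_twelve]; ring
  have h3' : PowerSeries.C (-(1 / 3) : k) = - (PowerSeries.C (1 / 12 : k) * 4) := by
    rw [show (4 : k⟦X⟧) = PowerSeries.C 4 from (map_ofNat PowerSeries.C 4).symm, ← map_mul, ← map_neg]
    congr 1
    have := t.twelve_ne; have := t.three_ne
    field_simp; norm_num
  rw [serreB_vQ, map_mul, evB_C, evB_vR, h3']
  linear_combination theta k t.Q * h3 - PowerSeries.C (1 / 12 : k) * 4 * t.thetaQ

lemma evB_serreB_vR : t.evB (serreB k (vR k)) =
    theta k t.R - PowerSeries.C (1 / 12 : k) * t.P * (6 * t.R) := by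
  have h3 : (PowerSeries.C (1 / 12 : k)) * 6 * 2 = 1 := by
    rw [← t.C_inv_twelve]; ring
  have h3' : PowerSeries.C (-(1 / 2) : k) = - (PowerSeries.C (1 / 12 : k) * 6) := by
    rw [show (6 : k⟦X⟧) = PowerSeries.C 6 from (map_ofNat PowerSeries.C 6).symm, ← map_mul, ← map_neg]
    congr 1
    have := t.twelve_ne; have := t.two_ne
    field_simp; norm_num
  rw [serreB_vR, map_mul, evB_C, map_pow, evB_vQ, h3']
  linear_combination theta k t.R * h3 - PowerSeries.C (1 / 12 : k) * 6 * t.thetaR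

lemma theta_evB (b : ModRing k) : theta k (t.evB b) =
    t.evB (serreB k b) + PowerSeries.C (1 / 12 : k) * t.P * t.evB ((grB k).euler b) := by
  induction b using modRing_induction with
  | hC c =>
    rw [serreB_C, (grB_C c).euler, evB_C, ← PowerSeries.algebraMap_eq, Derivation.map_algebraMap]
    simp
  | hadd f g hf hg => simp only [map_add, Grading.euler_add, hf, hg]; ring
  | hQ f hf =>
    have := t.evB_serreB_vQ
    rw [Derivation.leibniz, Grading.euler_mul, grB_vQ.euler]
    simp only [map_mul, map_add, smul_eq_mul, Derivation.leibniz, this, hf, evB_vQ, map_natCast]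
    push_cast
    ring
  | hR f hf =>
    have := t.evB_serreB_vR
    rw [Derivation.leibniz, Grading.euler_mul, grB_vR.euler]
    simp only [map_mul, map_add, smul_eq_mul, Derivation.leibniz, this, hf, evB_vR, map_natCast]
    push_cast
    ring

lemma euler_C (b : ModRing k) : (grA k).euler (C b) = C ((grB k).euler b) := by
  have h : homA k (C b) = ((grB k).hom b).map C := by
    have := homA_C_mul_X_pow b 0
    simpa using this
  change eval 1 (derivative (homA k (C b))) = _
  rw [h, derivative_map, ← C_1, eval_map, eval₂_hom]
  rfl

/-- The operator `dop` with the weight replaced by the Euler operator. -/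
def dfull (f : QModRing k) : QModRing k :=
  coeffwise (serreB k) f + C (MvPolynomial.C (1 / 12)) * X * (grA k).euler f
    - C (MvPolynomial.C (1 / 12)) * (X ^ 2 + C (vQ k)) * derivative f

lemma dfull_eq {f : QModRing k} {n : ℕ} (hf : (grA k).Hom n f) : dfull f = dop (n : k) f := by
  rw [dfull, dop, hf.euler, div_eq_mul_one_div (n : k) 12, map_mul, C_mul]
  simp only [map_natCast]
  ring

lemma dfull_add (f g : QModRing k) : dfull (f + g) = dfull f + dfull g := by
  simp only [dfull, coeffwise_add, Grading.euler_add, derivative_add]; ring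

lemma dfull_mul (f g : QModRing k) : dfull (f * g) = dfull f * g + f * dfull g := by
  simp only [dfull, coeffwise_mul, Grading.euler_mul, derivative_mul]; ring

/-- The transform of `dop` under `shift`, applied to `F`, with `e` in place of the weight times
`F`. -/
def nablaE (F e : k⟦X⟧[X]) : k⟦X⟧[X] :=
  coeffwise (theta k) F + C (PowerSeries.C (1 / 12)) * X * e
    - C (PowerSeries.C (1 / 12)) * X ^ 2 * derivative F

lemma shift_dfull (f : QModRing k) :
    t.shift (dfull f) = nablaE (t.shift f) (t.shift ((grA k).euler f)) := by
  have hX : t.shift (dfull X) = nablaE (t.shift X) (t.shift ((grA k).euler X)) := by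
    have h := t.theta_P_eq
    have h0 : coeffwise (serreB k) (X : QModRing k) = 0 := by
      simpa using coeffwise_X_pow (serreB k) 1
    have h1 : coeffwise (theta k) (X : k⟦X⟧[X]) = 0 := by
      simpa using coeffwise_X_pow (theta k) 1
    simp only [dfull, nablaE, Hom_X.euler, map_add, map_sub, map_mul, shift_X, shift_C, evB_C,
      coeffwise_add, coeffwise_C, h0, h1, map_zero, derivative_X, derivative_C, h,
      map_pow, map_natCast, map_one, evB_vQ]
    push_cast
    ring
  induction f using Polynomial.induction_on with
  | C b =>
    have h := t.theta_evB b
    simp only [dfull, nablaE, euler_C, map_add, map_sub, map_mul, shift_C, evB_C, shift_X,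
      coeffwise_C, derivative_C, h, map_zero]
    ring
  | add f g hf hg =>
    simp only [dfull_add, map_add, hf, hg, Grading.euler_add, nablaE, coeffwise_add]; ring
  | monomial n b hf =>
    rw [pow_succ, ← mul_assoc]
    generalize C b * X ^ n = g at *
    rw [dfull_mul, Grading.euler_mul, map_add, map_mul, map_mul, hf, hX, map_mul, map_add,
      map_mul, map_mul]
    simp only [nablaE, coeffwise_mul, derivative_mul]
    ring

/-- The transform of `dop n` under `shift`. -/
lemma shift_dop {f : QModRing k} {n : ℕ} (hf : (grA k).Hom n f) :
    t.shift (dop (n : k) f) = nablaE (t.shift f) (C (PowerSeries.C (n : k)) * t.shift f) := by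
  rw [← dfull_eq hf, shift_dfull, hf.euler, map_mul]
  simp

lemma evA_dop {f : QModRing k} {n : ℕ} (hf : (grA k).Hom n f) :
    t.evA (dop (n : k) f) = theta k (t.evA f) := by
  rw [← coeff_zero_shift, shift_dop t hf, nablaE, ← coeff_zero_shift]
  simp [mul_coeff_zero]

end RamanujanTriple

section Disc

variable {k : Type*} [Field k]

/-- The polynomial `E₄³ - E₆²`. -/
def vDisc (k : Type*) [Field k] : ModRing k := vQ k ^ 3 - vR k ^ 2

lemma grB_vDisc : (grB k).Hom 12 (vDisc k) := (grB_vQ.pow 3).sub (grB_vR.pow 2)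

/-- The value at the cusp. -/
def cusp (k : Type*) [Field k] : ModRing k →+* k := MvPolynomial.eval₂Hom (RingHom.id k) ![1, 1]

@[simp] lemma cusp_vQ : cusp k (vQ k) = 1 := by simp [cusp, vQ]

@[simp] lemma cusp_vR : cusp k (vR k) = 1 := by simp [cusp, vR]

@[simp] lemma cusp_C (c : k) : cusp k (MvPolynomial.C c) = c := by simp [cusp]

lemma vDisc_dvd_pow_sub (b c n : ℕ) (h : 4 * b + 6 * c = n) :
    vDisc k ∣ vQ k ^ b * vR k ^ c -
      vQ k ^ ((n / 2 - 3 * (n / 2 % 2)) / 2) * vR k ^ (n / 2 % 2) := by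
  have h1 : n / 2 % 2 = c % 2 := by omega
  have h2 : (n / 2 - 3 * (c % 2)) / 2 = b + 3 * (c / 2) := by omega
  rw [h1, h2]
  have h3 : vQ k ^ b * vR k ^ c - vQ k ^ (b + 3 * (c / 2)) * vR k ^ (c % 2) =
      -(vQ k ^ b * vR k ^ (c % 2) * ((vQ k ^ 3) ^ (c / 2) - (vR k ^ 2) ^ (c / 2))) := by
    conv_lhs => rw [← Nat.div_add_mod c 2]
    rw [pow_add, pow_add, pow_mul, pow_mul, Nat.mul_add_mod_self_left, Nat.mod_mod,
      Nat.mul_add_div (by norm_num), Nat.div_eq_of_lt (Nat.mod_lt c (by norm_num)), add_zero]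
    ring
  rw [h3, dvd_neg]
  exact Dvd.dvd.mul_left (sub_dvd_pow_sub_pow _ _ _) _

lemma monomial_eq_pow (d : Fin 2 →₀ ℕ) (c : k) :
    MvPolynomial.monomial d c = MvPolynomial.C c * (vQ k ^ d 0 * vR k ^ d 1) := by
  rw [MvPolynomial.monomial_eq, Finsupp.prod_fintype _ _ (fun i => by simp)]
  simp [vQ, vR]

lemma weight_eq (d : Fin 2 →₀ ℕ) :
    (d.sum fun i m => m * (![4, 6] : Fin 2 → ℕ) i) = 4 * d 0 + 6 * d 1 := by
  rw [Finsupp.sum_fintype _ _ (fun i => by simp)]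
  simp [mul_comm]

lemma vDisc_dvd_of_cusp_eq_zero {g : ModRing k} {n : ℕ} (hg : (grB k).Hom n g)
    (h0 : cusp k g = 0) : vDisc k ∣ g := by
  set m : ModRing k := vQ k ^ ((n / 2 - 3 * (n / 2 % 2)) / 2) * vR k ^ (n / 2 % 2) with hm
  have key : vDisc k ∣ g - MvPolynomial.C (cusp k g) * m := by
    have h1 : cusp k g = ∑ d ∈ g.support, g.coeff d := by
      conv_lhs => rw [← g.support_sum_monomial_coeff]
      rw [map_sum]
      exact Finset.sum_congr rfl fun d _ => by rw [monomial_eq_pow]; simp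
    have h2 : g - MvPolynomial.C (cusp k g) * m = ∑ d ∈ g.support,
        (MvPolynomial.monomial d (g.coeff d) - MvPolynomial.C (g.coeff d) * m) := by
      rw [Finset.sum_sub_distrib, g.support_sum_monomial_coeff, h1, map_sum, Finset.sum_mul]
    rw [h2]
    refine Finset.dvd_sum fun d hd => ?_
    rw [monomial_eq_pow, ← mul_sub]
    refine Dvd.dvd.mul_left (vDisc_dvd_pow_sub _ _ _ ?_) _
    rw [← weight_eq]
    exact weight_of_mem_support hg (MvPolynomial.mem_support_iff.1 hd)
  simpa [h0] using key

lemma vDisc_ne_zero (t : RamanujanTriple k) : vDisc k ≠ 0 := by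
  intro h
  apply t.disc_ne
  have : t.evB (vDisc k) = t.Q ^ 3 - t.R ^ 2 := by simp [vDisc]
  rw [← this, h, map_zero, map_zero]

end Disc

namespace RamanujanTriple

variable {k : Type*} [Field k] (t : RamanujanTriple k)

lemma constantCoeff_evB (b : ModRing k) :
    PowerSeries.constantCoeff (t.evB b) = cusp k b := by
  induction b using modRing_induction with
  | hC c => simp
  | hadd f g hf hg => simp [hf, hg]
  | hQ f hf => simp [hf, t.constQ]
  | hR f hf => simp [hf, t.constR]

lemma exists_evB_vDisc : ∃ u : k⟦X⟧, PowerSeries.constantCoeff u ≠ 0 ∧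
    t.evB (vDisc k) = PowerSeries.X * u := by
  have h0 : PowerSeries.constantCoeff (t.evB (vDisc k)) = 0 := by
    rw [constantCoeff_evB]; simp [vDisc]
  obtain ⟨u, hu⟩ := PowerSeries.X_dvd_iff.2 h0
  refine ⟨u, ?_, hu⟩
  have h1 : PowerSeries.coeff 1 (t.evB (vDisc k)) ≠ 0 := by
    have : t.evB (vDisc k) = t.Q ^ 3 - t.R ^ 2 := by simp [vDisc]
    rw [this]; exact t.disc_ne
  rw [hu, show (1 : ℕ) = 0 + 1 from rfl, PowerSeries.coeff_succ_X_mul] at h1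
  simpa using h1

/-- A modular form of weight `v` whose order of vanishing exceeds `v/12` is zero; the same holds
for order `(v - 2)/12`. -/
lemma eq_zero_of_X_pow_dvd_evB (d : ℕ) : ∀ (v : ℕ) (g : ModRing k), (grB k).Hom v g →
    PowerSeries.X ^ d ∣ t.evB g → (v < 12 * d ∨ v = 12 * d + 2) → g = 0 := by
  induction d with
  | zero =>
    intro v g hg _ h
    obtain rfl : v = 2 := by omega
    rw [MvPolynomial.eq_zero_iff]
    intro d
    by_contra hd
    have := weight_of_mem_support hg hd
    rw [weight_eq] at this
    omega
  | succ d ih =>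
    intro v g hg hd hv
    by_contra hg0
    have hc : cusp k g = 0 := by
      rw [← t.constantCoeff_evB]
      exact PowerSeries.X_dvd_iff.1 ((dvd_pow_self _ (Nat.succ_ne_zero d)).trans hd)
    obtain ⟨g', rfl⟩ := vDisc_dvd_of_cusp_eq_zero hg hc
    have hg'0 : g' ≠ 0 := right_ne_zero_of_mul hg0
    obtain ⟨hle, hg'⟩ := grB_vDisc.of_mul hg (vDisc_ne_zero t) hg'0
    refine hg'0 (ih (v - 12) g' hg' ?_ (by omega))
    obtain ⟨u, hu, hue⟩ := t.exists_evB_vDisc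
    rw [map_mul, hue, pow_succ, mul_assoc, mul_comm _ PowerSeries.X,
      mul_dvd_mul_iff_left PowerSeries.X_ne_zero] at hd
    have huu : IsUnit u := by
      rw [PowerSeries.isUnit_iff_constantCoeff]; exact hu.isUnit
    exact (huu.dvd_mul_left).1 hd

lemma eq_zero_of_evB_eq_zero {v : ℕ} {g : ModRing k} (hg : (grB k).Hom v g)
    (h : t.evB g = 0) : g = 0 :=
  t.eq_zero_of_X_pow_dvd_evB (v + 1) v g hg (by simp [h]) (by omega)

end RamanujanTriple

/-- An irreducible polynomial of positive degree over a UFD divides every element of an ideal that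
contains it and has trivial intersection with the ring of constants. -/
lemma irreducible_dvd_of_mem_ker {B S : Type*} [CommRing B] [IsDomain B]
    [UniqueFactorizationMonoid B] [CommRing S] (ψ : B[X] →+* S) (hψ : ∀ b, ψ (C b) = 0 → b = 0)
    {f g : B[X]} (hf : Irreducible f) (hf0 : ψ f = 0) (hg0 : ψ g = 0) :
    f.IsPrimitive ∧ f ∣ g := by
  have hdeg : f.natDegree ≠ 0 := by
    intro h
    rw [eq_C_of_natDegree_eq_zero h] at hf0
    have := hψ _ hf0
    rw [eq_C_of_natDegree_eq_zero h, this, C_0] at hf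
    exact hf.ne_zero rfl
  have hprim : f.IsPrimitive := hf.isPrimitive hdeg
  refine ⟨hprim, ?_⟩
  by_contra hdvd
  let K := FractionRing B
  have hirr : Irreducible (f.map (algebraMap B K)) :=
    hprim.irreducible_iff_irreducible_map_fraction_map.1 hf
  rw [hprim.dvd_iff_fraction_map_dvd_fraction_map K] at hdvd
  obtain ⟨a, b, hab⟩ := (hirr.coprime_iff_not_dvd).2 hdvd
  obtain ⟨c, hc, hca⟩ := IsLocalization.integerNormalization_spec (nonZeroDivisors B) a
  obtain ⟨d, hd, hdb⟩ := IsLocalization.integerNormalization_spec (nonZeroDivisors B) b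
  set a' := IsLocalization.integerNormalization (nonZeroDivisors B) a
  set b' := IsLocalization.integerNormalization (nonZeroDivisors B) b
  have key : C d * a' * f + C c * b' * g = C (c * d) := by
    apply map_injective (algebraMap B K) (IsFractionRing.injective B K)
    simp only [Polynomial.map_add, Polynomial.map_mul, map_C, hca, hdb, Algebra.smul_def,
      map_mul, Polynomial.algebraMap_apply]
    linear_combination C (algebraMap B K c) * C (algebraMap B K d) * hab
  have := congrArg ψ key
  rw [map_add, map_mul ψ _ f, map_mul ψ _ g, hf0, hg0, mul_zero, mul_zero, add_zero] at this
  have := hψ _ this.symm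
  rcases mul_eq_zero.1 this with h | h
  · exact nonZeroDivisors.ne_zero hc h
  · exact nonZeroDivisors.ne_zero hd h

lemma exists_irreducible_factor_mem_ker {A S : Type*} [CommRing A] [IsDomain A]
    [UniqueFactorizationMonoid A] [CommRing S] [IsDomain S] (ψ : A →+* S) (f : A) (hf : f ≠ 0)
    (h : ψ f = 0) : ∃ g, Irreducible g ∧ g ∣ f ∧ ψ g = 0 := by
  induction f using WfDvdMonoid.induction_on_irreducible with
  | zero => exact absurd rfl hf
  | unit u hu => exact absurd h (hu.map ψ).ne_zero
  | mul a i ha hi ih =>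
    rw [map_mul] at h
    rcases mul_eq_zero.1 h with h | h
    · exact ⟨i, hi, dvd_mul_right _ _, h⟩
    · obtain ⟨g, hg, hga, hg0⟩ := ih ha h
      exact ⟨g, hg, hga.mul_left i, hg0⟩

section

variable {k : Type*} [Field k]

lemma grB_hom_two {b : ModRing k} (hb : (grB k).Hom 2 b) : b = 0 := by
  ext d
  by_contra hd
  have := weight_of_mem_support hb hd
  rw [weight_eq] at this
  omega

lemma natDegree_le_of_hom {f : QModRing k} {n : ℕ} (hf : (grA k).Hom n f) :
    2 * f.natDegree ≤ n := by
  by_cases h : f = 0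
  · simp [h]
  · rcases Hom.coeff hf f.natDegree with h' | h'
    · exact absurd (leadingCoeff_eq_zero.1 h') h
    · exact h'.1

/-- The value of a quasimodular form at the cusp, as a polynomial in `E₂`. -/
def cuspA (k : Type*) [Field k] : QModRing k →+* k[X] := mapRingHom (cusp k)

lemma cusp_serreB (h12 : (12 : k) ≠ 0) (b : ModRing k) :
    12 * cusp k (serreB k b) = - cusp k ((grB k).euler b) := by
  have h3 : (3 : k) ≠ 0 := fun h => h12 (by rw [show (12 : k) = 4 * 3 by norm_num, h, mul_zero])
  have h2 : (2 : k) ≠ 0 := fun h => h12 (by rw [show (12 : k) = 6 * 2 by norm_num, h, mul_zero])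
  induction b using modRing_induction with
  | hC c => rw [serreB_C, (grB_C c).euler]; simp
  | hadd f g hf hg => simp only [map_add, Grading.euler_add, mul_add, hf, hg]; ring
  | hQ f hf =>
    rw [Derivation.leibniz, Grading.euler_mul, grB_vQ.euler, serreB_vQ]
    simp only [map_mul, map_add, smul_eq_mul, cusp_vQ, cusp_vR, cusp_C, map_natCast]
    have : (3 : k)⁻¹ * 3 = 1 := inv_mul_cancel₀ h3
    push_cast
    linear_combination hf - 4 * cusp k f * this
  | hR f hf =>
    rw [Derivation.leibniz, Grading.euler_mul, grB_vR.euler, serreB_vR]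
    simp only [map_mul, map_add, smul_eq_mul, cusp_vQ, cusp_vR, cusp_C, map_natCast, map_pow]
    have : (2 : k)⁻¹ * 2 = 1 := inv_mul_cancel₀ h2
    push_cast
    linear_combination hf - 6 * cusp k f * this

lemma coeff_X_mul_derivative (φ : k[X]) (l : ℕ) :
    (X * derivative φ).coeff l = l * φ.coeff l := by
  cases l with
  | zero => simp
  | succ l => rw [coeff_X_mul, coeff_derivative]; push_cast; ring

lemma cuspA_dop (h12 : (12 : k) ≠ 0) {f : QModRing k} {n : ℕ} (hf : (grA k).Hom n f) :
    12 * cuspA k (dop (n : k) f) =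
      C (n : k) * (X - 1) * cuspA k f - (X - 1) ^ 2 * derivative (cuspA k f) := by
  have h1 : 12 * cuspA k (coeffwise (serreB k) f) =
      2 * (X * derivative (cuspA k f)) - C (n : k) * cuspA k f := by
    ext l
    rw [show (12 : k[X]) = C 12 from (map_ofNat C 12).symm,
      show (2 : k[X]) = C 2 from (map_ofNat C 2).symm,
      coeff_sub, coeff_C_mul, coeff_C_mul, coeff_C_mul, coeff_X_mul_derivative]
    simp only [cuspA, coe_mapRingHom, coeff_map, coeff_coeffwise]
    rw [cusp_serreB h12]
    rcases Hom.coeff hf l with h | ⟨hl, h⟩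
    · rw [h, (Grading.Hom.zero 0).euler]; simp
    · rw [h.euler, map_mul, map_natCast, Nat.cast_sub hl]; push_cast; ring
  have h2 : (12 : k[X]) * C (1 / 12 : k) = 1 := by
    rw [show (12 : k[X]) = C 12 from (map_ofNat C 12).symm, ← C_mul, mul_one_div_cancel h12, C_1]
  have h3 : cuspA k (derivative f) = derivative (cuspA k f) := by
    simp [cuspA, derivative_map]
  have hX : cuspA k X = X := by simp [cuspA]
  have hC : ∀ b, cuspA k (C b) = C (cusp k b) := by simp [cuspA]
  rw [dop, map_sub, map_add, map_mul, map_mul, map_mul, map_mul, map_add, map_pow, hX, h3, hC, hC,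
    hC, cusp_C, cusp_C, cusp_vQ, C_1, div_eq_mul_one_div, C_mul]
  linear_combination h1 + (C (n : k) * X * cuspA k f - (X ^ 2 + 1) * derivative (cuspA k f)) * h2

lemma natCast_eq_of_cusp_equation {n : k} {c : k} {φ : k[X]} (hφ : φ ≠ 0)
    (h12 : (12 : k) ≠ 0) (h : 12 * (C c * X * φ) =
      C n * (X - 1) * φ - (X - 1) ^ 2 * derivative φ) :
    n = (φ.rootMultiplicity 1 : ℕ) := by
  obtain ⟨ξ, hξ, hnd⟩ := exists_eq_pow_rootMultiplicity_mul_and_not_dvd φ hφ 1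
  set e := φ.rootMultiplicity 1
  have hξ1 : ξ.eval 1 ≠ 0 := fun h0 => hnd (dvd_iff_isRoot.2 h0)
  rw [C_1] at hξ
  have hX1 : (X - 1 : k[X]) ≠ 0 := by rw [← C_1]; exact X_sub_C_ne_zero 1
  have hd : (X - 1) * derivative φ = (X - 1) ^ e * (C (e : k) * ξ + (X - 1) * derivative ξ) := by
    rw [hξ, derivative_mul, derivative_pow]
    cases e with
    | zero => simp
    | succ e => simp [pow_succ]; ring
  have h1 : (X - 1) ^ e * (12 * (C c * X * ξ)) = (X - 1) ^ e *
      ((X - 1) * (C n * ξ - (C (e : k) * ξ + (X - 1) * derivative ξ))) := by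
    linear_combination (exp := 1) h - (X - 1) * hd + (12 * C c * X - C n * (X - 1)) * (-1) * hξ
  have h2 := mul_left_cancel₀ (pow_ne_zero e hX1) h1
  have hc : c = 0 := by
    have := congrArg (eval 1) h2
    simp only [eval_mul, eval_C, eval_X, eval_sub, eval_one, sub_self, zero_mul, eval_ofNat,
      mul_one] at this
    rcases mul_eq_zero.1 this with h | h
    · exact absurd h h12
    · exact (mul_eq_zero.1 h).resolve_right hξ1
  rw [hc] at h2
  simp only [C_0, zero_mul, mul_zero] at h2
  have h3 := congrArg (eval 1) ((mul_eq_zero.1 h2.symm).resolve_left hX1)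
  simp only [eval_mul, eval_C, eval_X, eval_sub, eval_add, eval_one, sub_self, zero_mul, add_zero,
    eval_zero] at h3
  rw [← sub_mul] at h3
  exact sub_eq_zero.1 ((mul_eq_zero.1 h3).resolve_right hξ1)

end

namespace RamanujanTriple

variable {k : Type*} [Field k] (t : RamanujanTriple k)

/-- Substitution of the series, recording the weight. -/
def evT : QModRing k →+* k⟦X⟧[X] := (mapRingHom t.evA).comp (homA k)

lemma evT_of_hom {f : QModRing k} {n : ℕ} (hf : (grA k).Hom n f) :
    t.evT f = C (t.evA f) * X ^ n := by
  have : homA k f = C f * X ^ n := hf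
  simp [evT, this]

lemma evT_C_eq_zero {b : ModRing k} (h : t.evT (C b) = 0) : b = 0 := by
  have h1 : homA k (C b) = ((grB k).hom b).map C := by
    simpa using homA_C_mul_X_pow b 0
  apply Grading.hom_injective (G := grB k)
  rw [map_zero]
  ext1 n
  refine t.eq_zero_of_evB_eq_zero (Grading.hom_component b n) ?_
  have := congrArg (fun g => Polynomial.coeff g n) h
  simpa [evT, h1, evA] using this

lemma constantCoeff_evA (f : QModRing k) :
    PowerSeries.constantCoeff (t.evA f) = (cuspA k f).eval 1 := by
  induction f using Polynomial.induction_on' with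
  | add f g hf hg => simp only [map_add, eval_add, hf, hg]
  | monomial i b => simp [evA, cuspA, t.constP, constantCoeff_evB]

/-- In characteristic `p`, a nonzero quasimodular polynomial of weight at most `p` does not vanish
identically on the series. -/
theorem evA_ne_zero {p : ℕ} [CharP k p] {f : QModRing k} {w : ℕ} (hw : w ≤ p)
    (hf : (grA k).Hom w f) (hf0 : f ≠ 0) : t.evA f ≠ 0 := by
  intro hev
  have hψ : ∀ b, t.evT (C b) = 0 → b = 0 := fun b => t.evT_C_eq_zero
  obtain ⟨g, hg, ⟨h, hgh⟩, hg0⟩ := exists_irreducible_factor_mem_ker t.evT f hf0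
    (by rw [t.evT_of_hom hf, hev]; simp)
  have hgne : g ≠ 0 := hg.ne_zero
  have hhne : h ≠ 0 := by rintro rfl; exact hf0 (by rw [hgh, mul_zero])
  have hinj : Function.Injective (homA k) := Grading.hom_injective (G := grA k)
  have hhom : ∀ {a : QModRing k}, a ≠ 0 → homA k a ≠ 0 := fun ha h0 =>
    ha (hinj (by rw [h0, map_zero]))
  set n := (homA k g).natDegree with hn
  have hnw : n ≤ w := by
    have h1 : homA k f = C f * X ^ w := hf
    have h2 := congrArg natDegree h1
    rw [natDegree_C_mul_X_pow _ _ hf0, hgh, map_mul,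
      natDegree_mul (hhom hgne) (hhom hhne)] at h2
    omega
  set c := (homA k g).coeff n with hc
  have hc0 : c ≠ 0 := by
    rw [hc, hn]; exact leadingCoeff_ne_zero.2 (hhom hgne)
  have hcn : (grA k).Hom n c := Grading.hom_component g n
  have hcker : t.evT c = 0 := by
    rw [t.evT_of_hom hcn]
    have := congrArg (fun q => Polynomial.coeff q n) hg0
    simp only [evT, RingHom.comp_apply, coe_mapRingHom, coeff_map, coeff_zero] at this
    rw [hc, this]; simp
  obtain ⟨hprim, u, hu⟩ := irreducible_dvd_of_mem_ker t.evT hψ hg hg0 hcker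
  have hune : u ≠ 0 := by rintro rfl; exact hc0 (by rw [hu, mul_zero])
  have hu0 : (grA k).Hom 0 u := by
    have h1 : homA k c = C c * X ^ n := hcn
    have h2 := congrArg natDegree h1
    rw [natDegree_C_mul_X_pow _ _ hc0, hu, map_mul, natDegree_mul (hhom hgne) (hhom hune)] at h2
    have h3 : (homA k u).natDegree = 0 := by omega
    have h4 := eq_C_of_natDegree_eq_zero h3
    have h5 := (grA k).counit u
    change eval 1 (homA k u) = u at h5
    rw [h4, eval_C] at h5
    rw [h5] at h4
    change homA k u = _
    rw [h4, pow_zero, mul_one]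
  have hgn : (grA k).Hom n g := by
    rw [hu, mul_comm] at hcn
    simpa using (hu0.of_mul hcn hune hgne).2
  have hgev : t.evA g = 0 := by
    have := t.evT_of_hom hgn
    rw [hg0] at this
    have := congrArg (fun q => Polynomial.coeff q n) this
    simpa using this.symm
  have hdop : t.evT (dop (n : k) g) = 0 := by
    rw [t.evT_of_hom (Hom.dop _ hgn), t.evA_dop hgn, hgev]; simp
  obtain ⟨-, v, hv⟩ := irreducible_dvd_of_mem_ker t.evT hψ hg hg0 hdop
  have hvX : ∃ a : k, cuspA k v = C a * X := by
    by_cases hv0 : v = 0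
    · exact ⟨0, by simp [hv0]⟩
    have h1 := Hom.dop (n : k) hgn
    rw [hv] at h1
    have h2 := (hgn.of_mul h1 hgne hv0).2
    rw [Nat.add_sub_cancel_left] at h2
    refine ⟨cusp k (v.coeff 1), ?_⟩
    ext l
    rw [coeff_C_mul, coeff_X]
    simp only [cuspA, coe_mapRingHom, coeff_map]
    rcases Hom.coeff h2 l with h | ⟨hl, h⟩
    · rw [h]
      split_ifs with h1
      · rw [h1, h]; simp
      · simp
    · split_ifs with h1
      · rw [← h1, mul_one]
      · have : l = 0 := by omega
        subst this
        rw [grB_hom_two h]; simp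
  obtain ⟨a, ha⟩ := hvX
  have hφ0 : cuspA k g ≠ 0 := by
    intro h0
    have h1 : C (vDisc k) ∣ g := by
      rw [C_dvd_iff_dvd_coeff]
      intro l
      have h2 := congrArg (fun q => Polynomial.coeff q l) h0
      simp only [cuspA, coe_mapRingHom, coeff_map, coeff_zero] at h2
      rcases Hom.coeff hgn l with h | ⟨-, h⟩
      · rw [h]; exact dvd_zero _
      · exact vDisc_dvd_of_cusp_eq_zero h h2
    have h2 := (hprim _ h1).map (cusp k)
    simp [vDisc] at h2
  have heq := cuspA_dop t.twelve_ne hgn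
  rw [hv, map_mul, ha, mul_comm (cuspA k g)] at heq
  have hne := natCast_eq_of_cusp_equation hφ0 t.twelve_ne heq
  set e := (cuspA k g).rootMultiplicity 1 with he
  have he1 : 0 < e := by
    rw [he, rootMultiplicity_pos hφ0, IsRoot, ← t.constantCoeff_evA, hgev, map_zero]
  have he2 : e ≤ (cuspA k g).natDegree :=
    (rootMultiplicity_le_iff hφ0 1 _).2 (fun hd => by
      have := natDegree_le_of_dvd hd hφ0
      rw [natDegree_pow, natDegree_X_sub_C] at this
      omega)
  have he3 : (cuspA k g).natDegree ≤ g.natDegree := natDegree_map_le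
  have he4 := natDegree_le_of_hom hgn
  have hmod := (CharP.natCast_eq_natCast k p).1 hne
  have hdvd := (Nat.modEq_iff_dvd' (by omega : e ≤ n)).1 hmod.symm
  have := Nat.le_of_dvd (by omega) hdvd
  omega

end RamanujanTriple

section Connection

variable {k S : Type*} [CommRing k] [CommRing S] [Algebra k S]

/-- The connection `∇F = θF + κ · (shift of F)` on sequences. -/
def nabla (θ : Derivation k S S) (κ : ℕ → S) (F : ℕ → S) : ℕ → S
  | 0 => θ (F 0)
  | m + 1 => θ (F (m + 1)) + κ (m + 1) * F m

lemma nabla_add (θ : Derivation k S S) (κ : ℕ → S) (F G : ℕ → S) :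
    nabla θ κ (F + G) = nabla θ κ F + nabla θ κ G := by
  funext m
  cases m <;> simp [nabla]; ring

lemma nabla_smul (θ : Derivation k S S) (κ : ℕ → S) (a : S) (F : ℕ → S) :
    nabla θ κ (a • F) = a • nabla θ κ F + θ a • F := by
  funext m
  cases m <;> simp [nabla] <;> ring

/-- Prepending a zero to a sequence. -/
def prependZero (S : Type*) [CommRing S] : (ℕ → S) →ₗ[S] (ℕ → S) where
  toFun G m := Nat.casesOn m 0 G
  map_add' G H := by funext m; cases m <;> simp
  map_smul' a G := by funext m; cases m <;> simp

lemma nabla_prependZero (θ : Derivation k S S) (κ : ℕ → S) (G : ℕ → S) :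
    nabla θ κ (prependZero S G) = prependZero S (nabla θ (fun m => κ (m + 1)) G) := by
  funext m
  rcases m with _ | _ | m <;> simp [nabla, prependZero]

/-- Cyclicity of the first vector for the connection: a linear functional killing the derivatives
of a sequence with nonvanishing first entry is zero. -/
theorem functional_eq_zero [IsDomain S] (θ : Derivation k S S) (n : ℕ) :
    ∀ (κ : ℕ → S) (F y : ℕ → S) (U : ℕ → Submodule S (ℕ → S)),
      (∀ m, 1 ≤ m → m ≤ n → ∀ a b : S, a ≠ 0 → a * θ b - b * θ a + κ m * a ^ 2 ≠ 0) →
      F 0 ≠ 0 → F ∈ U 0 → (∀ j, U j ≤ U (j + 1)) →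
      (∀ j, ∀ G ∈ U j, nabla θ κ G ∈ U (j + 1)) →
      (∀ G ∈ U n, ∑ m ∈ range (n + 1), y m * G m = 0) → ∀ m ≤ n, y m = 0 := by
  induction n with
  | zero =>
    intro κ F y U _ hF0 hF _ _ hy m hm
    have := hy F hF
    rw [Nat.le_zero.1 hm]
    simpa [hF0] using this
  | succ n ih =>
    intro κ F y U hκ hF0 hF hmono hnab hy
    have hFU : ∀ j, F ∈ U j := fun j => by
      induction j with
      | zero => exact hF
      | succ j ihj => exact hmono j ihj
    set H : ℕ → S := F 0 • nabla θ κ F - θ (F 0) • F with hH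
    have hHU : H ∈ U 1 :=
      Submodule.sub_mem _ (Submodule.smul_mem _ _ (hnab 0 F hF)) (Submodule.smul_mem _ _ (hFU 1))
    have hHs : prependZero S (fun m => H (m + 1)) = H := by
      funext m
      cases m with
      | zero => simp [prependZero, hH, nabla, mul_comm]
      | succ m => rfl
    have hsucc : ∀ m ≤ n, y (m + 1) = 0 := by
      refine ih (fun m => κ (m + 1)) (fun m => H (m + 1)) (fun m => y (m + 1))
        (fun j => (U (j + 1)).comap (prependZero S)) ?_ ?_ ?_ ?_ ?_ ?_
      · exact fun m h1 hm => hκ (m + 1) (by omega) (by omega)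
      · have := hκ 1 le_rfl (by omega) (F 0) (F 1) hF0
        convert this using 1
        simp only [hH, nabla, Pi.sub_apply, Pi.smul_apply, smul_eq_mul]
        ring
      · rw [Submodule.mem_comap, hHs]; exact hHU
      · exact fun j => Submodule.comap_mono (hmono (j + 1))
      · intro j G hG
        rw [Submodule.mem_comap, ← nabla_prependZero]
        exact hnab (j + 1) _ hG
      · intro G hG
        have := hy _ hG
        rw [Finset.sum_range_succ'] at this
        simpa [prependZero] using this
    intro m hm
    cases m with
    | succ m => exact hsucc m (by omega)
    | zero =>
      have := hy F (hFU _)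
      rw [Finset.sum_range_succ', Finset.sum_eq_zero, zero_add] at this
      · exact (mul_eq_zero.1 this).resolve_right hF0
      · intro m hm
        rw [hsucc m (by have := Finset.mem_range.1 hm; omega), zero_mul]

end Connection

/-- In characteristic `p`, the equation `θ(b/a) = -c` has no solution for constant `c ≠ 0`. -/
lemma theta_riccati_ne_zero {k : Type*} [Field k] {p : ℕ} (hp : p.Prime) [CharP k p] {c : k}
    (hc : c ≠ 0) (a b : k⟦X⟧) (ha : a ≠ 0) :
    a * theta k b - b * theta k a + PowerSeries.C c * a ^ 2 ≠ 0 := by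
  intro h
  obtain ⟨q, rfl⟩ : ∃ q, p = q + 2 := ⟨p - 2, by have := hp.two_le; omega⟩
  have hcast : ((q + 2 : ℕ) : k⟦X⟧) = 0 := by
    rw [← map_natCast (PowerSeries.C (R := k)), CharP.cast_eq_zero, map_zero]
  have h1 : theta k (b * a ^ (q + 1)) = - (PowerSeries.C c * a ^ (q + 2)) := by
    rw [Derivation.leibniz, Derivation.leibniz_pow]
    simp only [smul_eq_mul, nsmul_eq_mul, Nat.add_sub_cancel]
    push_cast at hcast ⊢
    linear_combination a ^ q * h + b * a ^ q * theta k a * hcast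
  obtain ⟨n, u, hu, rfl⟩ : ∃ (n : ℕ) (u : k⟦X⟧), PowerSeries.constantCoeff u ≠ 0 ∧
      a = PowerSeries.X ^ n * u := by
    obtain ⟨u, hu⟩ := PowerSeries.X_pow_order_dvd (φ := a)
    have hc := PowerSeries.coeff_order ha
    generalize a.order.toNat = n at hu hc
    refine ⟨n, u, ?_, hu⟩
    rwa [hu, PowerSeries.coeff_X_pow_mul', if_pos le_rfl, Nat.sub_self,
      PowerSeries.coeff_zero_eq_constantCoeff_apply] at hc
  have h2 := congrArg (PowerSeries.coeff ((q + 2) * n)) h1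
  rw [coeff_theta, Nat.cast_mul, CharP.cast_eq_zero, zero_mul, zero_mul, map_neg,
    PowerSeries.coeff_C_mul, mul_pow, ← pow_mul, mul_comm n (q + 2),
    PowerSeries.coeff_X_pow_mul', if_pos le_rfl, Nat.sub_self] at h2
  have h3 : c * PowerSeries.constantCoeff u ^ (q + 2) = 0 := by
    simpa using h2.symm
  exact mul_ne_zero hc (pow_ne_zero _ hu) h3

section Wronskian

variable {k : Type*} [Field k]

lemma natDegree_dop_le {f : QModRing k} {s : ℕ} (hf : f.natDegree ≤ s) :
    (dop (s : k) f).natDegree ≤ s := by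
  rw [natDegree_le_iff_coeff_eq_zero] at hf ⊢
  intro l hl
  obtain ⟨l, rfl⟩ : ∃ m, l = m + 1 := ⟨l - 1, by omega⟩
  have h1 : (C (MvPolynomial.C ((s : k) / 12)) * X * f).coeff (l + 1) =
      MvPolynomial.C ((s : k) / 12) * f.coeff l := by
    rw [mul_assoc, coeff_C_mul, coeff_X_mul]
  have h2 : (X ^ 2 * derivative f).coeff (l + 1) = f.coeff l * (l : ModRing k) := by
    cases l with
    | zero => simp [coeff_X_pow_mul']
    | succ l => rw [show l + 1 + 1 = l + 2 from rfl, coeff_X_pow_mul, coeff_derivative]; push_cast; rfl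
  have h3 : (C (MvPolynomial.C (1 / 12 : k)) * (X ^ 2 + C (vQ k)) * derivative f).coeff (l + 1) =
      MvPolynomial.C (1 / 12 : k) * (f.coeff l * (l : ModRing k)) := by
    rw [mul_assoc, coeff_C_mul, add_mul, coeff_add, h2, coeff_C_mul, coeff_derivative,
      hf (l + 1 + 1) (by omega)]
    simp
  rw [dop, coeff_sub, coeff_add, h1, h3, coeff_coeffwise, hf (l + 1) hl, map_zero, zero_add]
  rcases Nat.lt_or_ge s l with h | h
  · rw [hf l h]; simp
  · obtain rfl : l = s := by omega
    rw [div_eq_mul_one_div, map_mul, map_natCast]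
    ring

lemma dop_sub_dop (m n : k) (f : QModRing k) :
    dop m f = dop n f - C (MvPolynomial.C ((n - m) / 12)) * X * f := by
  rw [dop, dop, show m / 12 = n / 12 - (n - m) / 12 by ring, map_sub, C_sub]
  ring

namespace RamanujanTriple

variable (t : RamanujanTriple k)

lemma coeff_shift_dop {f : QModRing k} {n : ℕ} (hf : (grA k).Hom n f) (s m : ℕ) :
    (t.shift (dop (s : k) f)).coeff m =
      nabla (theta k) (fun m => PowerSeries.C (((s : k) + 1 - m) / 12)) (t.shift f).coeff m
        - PowerSeries.C (((n : k) - s) / 12) * t.P * (t.shift f).coeff m := by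
  rw [dop_sub_dop (s : k) n, map_sub, shift_dop t hf, map_mul, map_mul, shift_C, shift_X, evB_C]
  generalize t.shift f = F
  cases m with
  | zero => simp [nablaE, nabla, mul_coeff_zero]
  | succ m =>
    have h2 : (X ^ 2 * derivative F).coeff (m + 1) = F.coeff m * (m : k⟦X⟧) := by
      cases m with
      | zero => simp [coeff_X_pow_mul']
      | succ l =>
        rw [show l + 1 + 1 = l + 2 from rfl, coeff_X_pow_mul, coeff_derivative]; push_cast; rfl
    have h3 : PowerSeries.C (((s : k) + 1 - (m + 1 : ℕ)) / 12) =
        PowerSeries.C (1 / 12 : k) * PowerSeries.C (n : k) - PowerSeries.C (1 / 12 : k) * m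
          - PowerSeries.C (((n : k) - s) / 12) := by
      rw [← map_natCast (PowerSeries.C (R := k)) m, ← map_mul, ← map_mul, ← map_sub, ← map_sub]
      congr 1
      push_cast
      ring
    have h4 : (C (PowerSeries.C (1 / 12 : k)) * X * (C (PowerSeries.C (n : k)) * F)).coeff (m + 1) =
        PowerSeries.C (1 / 12 : k) * PowerSeries.C (n : k) * F.coeff m := by
      rw [mul_assoc, coeff_C_mul, coeff_X_mul, coeff_C_mul, mul_assoc]
    have h5 : (C (PowerSeries.C (1 / 12 : k)) * X ^ 2 * derivative F).coeff (m + 1) =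
        PowerSeries.C (1 / 12 : k) * (F.coeff m * (m : k⟦X⟧)) := by
      rw [mul_assoc, coeff_C_mul, h2]
    have h6 : (C (PowerSeries.C (((n : k) - s) / 12)) * (X + C t.P) * F).coeff (m + 1) =
        PowerSeries.C (((n : k) - s) / 12) * (F.coeff m + t.P * F.coeff (m + 1)) := by
      rw [mul_assoc, coeff_C_mul, add_mul, coeff_add, coeff_X_mul, coeff_C_mul]
    rw [coeff_sub, nablaE, coeff_sub, coeff_add, h4, h5, h6, coeff_coeffwise, nabla, h3]
    ring

lemma X_pow_dvd_evA_dop {f : QModRing k} {n N : ℕ} (hf : (grA k).Hom n f) (s : ℕ)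
    (h : PowerSeries.X ^ N ∣ t.evA f) : PowerSeries.X ^ N ∣ t.evA (dop (s : k) f) := by
  rw [← coeff_zero_shift, coeff_shift_dop t hf, nabla, coeff_zero_shift]
  refine dvd_sub ?_ (h.mul_left _)
  rw [PowerSeries.X_pow_dvd_iff] at h ⊢
  intro m hm
  rw [coeff_theta, h m hm, mul_zero]

/-- The weight of the Wronskian determinant of forms of weights `w`, `w + 2`, …. -/
lemma hom_det {s w : ℕ} {v : ℕ → QModRing k} (hv : ∀ j, (grA k).Hom (w + 2 * j) (v j)) :
    (grB k).Hom ((s + 1) * w)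
      (Matrix.of fun l j : Fin (s + 1) => (v j).coeff l).det := by
  set M : Matrix (Fin (s + 1)) (Fin (s + 1)) (ModRing k) :=
    Matrix.of fun l j : Fin (s + 1) => (v j).coeff l with hM
  by_cases h0 : M.det = 0
  · rw [h0]; exact Grading.Hom.zero _
  have h1 : X ^ (∑ l : Fin (s + 1), 2 * (l : ℕ)) * (grB k).hom M.det =
      C M.det * X ^ (∑ j : Fin (s + 1), (w + 2 * (j : ℕ))) := by
    rw [← Finset.prod_pow_eq_pow_sum, ← Finset.prod_pow_eq_pow_sum, RingHom.map_det,
      RingHom.map_det, mul_comm _ (∏ _, _), ← Matrix.det_mul_column, ← Matrix.det_mul_row]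
    congr 1
    ext1 l j
    have := grA_hom_iff.1 (hv j) l
    simp only [Matrix.of_apply, RingHom.mapMatrix_apply, Matrix.map_apply, hM]
    rw [this, mul_comm]
  have h2 := (Grading.le_and_hom_of_mul_X_pow h0 h1).2
  have h3 : ∑ j : Fin (s + 1), (w + 2 * (j : ℕ)) - ∑ l : Fin (s + 1), 2 * (l : ℕ) =
      (s + 1) * w := by
    rw [Finset.sum_add_distrib, Nat.add_sub_cancel]
    simp
  rwa [h3] at h2

lemma evA_eq_sum {f : QModRing k} {s : ℕ} (hf : f.natDegree ≤ s) :
    t.evA f = ∑ l : Fin (s + 1), t.P ^ (l : ℕ) * t.evB (f.coeff l) := by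
  rw [evA, coe_eval₂RingHom, eval₂_eq_sum_range' _ (Nat.lt_succ_of_le hf),
    Finset.sum_range]
  exact Finset.sum_congr rfl fun l _ => mul_comm _ _

lemma X_pow_dvd_evB_det {s N : ℕ} {v : ℕ → QModRing k} (hdeg : ∀ j, (v j).natDegree ≤ s)
    (hv : ∀ j, PowerSeries.X ^ N ∣ t.evA (v j)) :
    PowerSeries.X ^ N ∣ t.evB (Matrix.of fun l j : Fin (s + 1) => (v j).coeff l).det := by
  set M : Matrix (Fin (s + 1)) (Fin (s + 1)) (ModRing k) :=
    Matrix.of fun l j : Fin (s + 1) => (v j).coeff l with hM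
  have h1 : (fun l : Fin (s + 1) => t.P ^ (l : ℕ)) ᵥ* (t.evB.mapMatrix M) =
      fun j : Fin (s + 1) => t.evA (v j) := by
    funext j
    rw [evA_eq_sum t (hdeg j)]
    rfl
  have h2 := congrArg (fun x => x ᵥ* (t.evB.mapMatrix M).adjugate) h1
  simp only [Matrix.vecMul_vecMul, Matrix.mul_adjugate, Matrix.vecMul_smul,
    Matrix.vecMul_one] at h2
  have h3 := congrFun h2 0
  simp only [Pi.smul_apply, Fin.val_zero, pow_zero, smul_eq_mul, mul_one] at h3
  rw [RingHom.map_det, h3, Matrix.vecMul, dotProduct]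
  exact Finset.dvd_sum fun j _ => (hv j).mul_right _

/-- A quasimodular form in characteristic `p ≥ w` cannot vanish at infinity to an order larger
than the one allowed by its Wronskian. -/
theorem eq_zero_of_X_pow_dvd_evA {p : ℕ} (hp : p.Prime) [CharP k p] {s w N : ℕ} (hs : s < p)
    (hw : w ≤ p) {f : QModRing k} (hf : (grA k).Hom w f) (hdeg : f.natDegree ≤ s)
    (hN : PowerSeries.X ^ N ∣ t.evA f)
    (hlt : (s + 1) * w < 12 * N ∨ (s + 1) * w = 12 * N + 2) : f = 0 := by
  by_contra hf0
  set v : ℕ → QModRing k := fun j => (dop (s : k))^[j] f with hv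
  have hsucc : ∀ j, v (j + 1) = dop (s : k) (v j) := fun j => Function.iterate_succ_apply' _ _ _
  have hvhom : ∀ j, (grA k).Hom (w + 2 * j) (v j) := fun j => by
    induction j with
    | zero => exact hf
    | succ j ih => rw [hsucc]; exact Hom.dop _ ih
  have hvdeg : ∀ j, (v j).natDegree ≤ s := fun j => by
    induction j with
    | zero => exact hdeg
    | succ j ih => rw [hsucc]; exact natDegree_dop_le ih
  have hvdvd : ∀ j, PowerSeries.X ^ N ∣ t.evA (v j) := fun j => by
    induction j with
    | zero => exact hN
    | succ j ih => rw [hsucc]; exact X_pow_dvd_evA_dop t (hvhom j) s ih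
  have hdet := eq_zero_of_X_pow_dvd_evB t N _ _ (hom_det (s := s) hvhom)
    (X_pow_dvd_evB_det t hvdeg hvdvd) hlt
  set M : Matrix (Fin (s + 1)) (Fin (s + 1)) (ModRing k) :=
    Matrix.of fun l j : Fin (s + 1) => (v j).coeff l with hM
  have hdet' : (t.evB.mapMatrix M).det = 0 := by rw [← RingHom.map_det, hdet, map_zero]
  obtain ⟨y, hy0, hy⟩ := Matrix.exists_vecMul_eq_zero_iff.2 hdet'
  set L : k⟦X⟧[X] →ₗ[k⟦X⟧] k⟦X⟧ := ∑ l : Fin (s + 1), y l • lcoeff k⟦X⟧ (l : ℕ) with hL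
  have hLapp : ∀ h : k⟦X⟧[X], L h = ∑ l : Fin (s + 1), y l * h.coeff l := fun h => by
    simp [hL, LinearMap.sum_apply]
  have hcomp : ∀ G : k⟦X⟧[X], G.natDegree ≤ s → L (G.comp (X - C t.P)) =
      ∑ m ∈ range (s + 1), L ((X - C t.P) ^ m) * G.coeff m := fun G hG => by
    rw [comp, eval₂_eq_sum_range' _ (Nat.lt_succ_of_le hG), map_sum]
    refine Finset.sum_congr rfl fun m _ => ?_
    rw [← smul_eq_C_mul, map_smul, smul_eq_mul, mul_comm]
  have hshift : ∀ g : QModRing k, (t.shift g).comp (X - C t.P) = g.map t.evB := fun g => by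
    induction g using Polynomial.induction_on' with
    | add f g hf hg => simp only [map_add, add_comp, hf, hg, Polynomial.map_add]
    | monomial i b =>
      rw [← C_mul_X_pow_eq_monomial, map_mul, map_pow, shift_C, shift_X]
      simp
  have hshiftdeg : ∀ g : QModRing k, g.natDegree ≤ s → (t.shift g).natDegree ≤ s := fun g hg => by
    have h1 : t.shift g = (g.map t.evB).comp (X + C t.P) := by
      rw [← hshift, comp_assoc]; simp
    rw [h1]
    refine natDegree_comp_le.trans ?_
    rw [natDegree_X_add_C, mul_one]
    exact natDegree_map_le.trans hg
  have hkill : ∀ j ≤ s, L ((v j).map t.evB) = 0 := fun j hj => by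
    rw [hLapp]
    have := congrFun hy ⟨j, by omega⟩
    simpa [Matrix.vecMul, dotProduct, hM] using this
  set U : ℕ → Submodule k⟦X⟧ (ℕ → k⟦X⟧) := fun j =>
    Submodule.span k⟦X⟧ ((fun i => (t.shift (v i)).coeff) '' Set.Iic j) with hU
  have hmem : ∀ i j, i ≤ j → (t.shift (v i)).coeff ∈ U j := fun i j hij =>
    Submodule.subset_span ⟨i, hij, rfl⟩
  have hmono : ∀ j, U j ≤ U (j + 1) := fun j =>
    Submodule.span_mono (Set.image_mono (Set.Iic_subset_Iic.2 j.le_succ))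
  have hy' := functional_eq_zero (theta k) s
    (fun m => PowerSeries.C (((s : k) + 1 - m) / 12)) (t.shift f).coeff
    (fun m => L ((X - C t.P) ^ m)) U ?_ ?_ (hmem 0 0 le_rfl) hmono ?_ ?_
  · apply hy0
    funext l
    have h1 : L (X ^ (l : ℕ)) = y l := by
      rw [hLapp, Finset.sum_eq_single l]
      · simp
      · intro b _ hb
        rw [coeff_X_pow, if_neg (fun h => hb (Fin.ext h)), mul_zero]
      · simp
    have h2 : (X ^ (l : ℕ) : k⟦X⟧[X]) = ((X + C t.P) ^ (l : ℕ)).comp (X - C t.P) := by simp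
    rw [← h1, h2, hcomp, Finset.sum_eq_zero, Pi.zero_apply]
    · intro m hm
      rw [hy' m (by have := Finset.mem_range.1 hm; omega), zero_mul]
    · refine natDegree_pow_le.trans ?_
      rw [natDegree_X_add_C, mul_one]
      exact Nat.lt_succ_iff.1 l.2
  · intro m h1 hm a b ha
    refine theta_riccati_ne_zero hp (div_ne_zero ?_ t.twelve_ne) a b ha
    have h2 : (s : k) + 1 - m = ((s + 1 - m : ℕ) : k) := by
      rw [Nat.cast_sub (by omega)]; push_cast; rfl
    rw [h2, Ne, CharP.cast_eq_zero_iff k p]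
    exact Nat.not_dvd_of_pos_of_lt (by omega) (by omega)
  · rw [coeff_zero_shift]
    exact evA_ne_zero t hw hf hf0
  · intro j G hG
    induction hG using Submodule.span_induction with
    | mem G hG =>
      obtain ⟨i, hi, rfl⟩ := hG
      have h1 := hmem (i + 1) (j + 1) (Nat.succ_le_succ hi)
      have h2 : nabla (theta k) (fun m => PowerSeries.C (((s : k) + 1 - m) / 12))
          (t.shift (v i)).coeff = (t.shift (v (i + 1))).coeff +
            (PowerSeries.C ((((w + 2 * i : ℕ) : k) - s) / 12) * t.P) • (t.shift (v i)).coeff := by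
        funext m
        rw [Pi.add_apply, Pi.smul_apply, smul_eq_mul, hsucc, coeff_shift_dop t (hvhom i)]
        ring
      change nabla (theta k) _ (t.shift (v i)).coeff ∈ _
      rw [h2]
      exact Submodule.add_mem _ h1 (Submodule.smul_mem _ _ (hmem i (j + 1) (Nat.le_succ_of_le hi)))
    | zero =>
      have : nabla (theta k) (fun m => PowerSeries.C (((s : k) + 1 - m) / 12)) 0 = 0 := by
        funext m; cases m <;> simp [nabla]
      rw [this]; exact Submodule.zero_mem _
    | add x y _ _ hx hy => rw [nabla_add]; exact Submodule.add_mem _ hx hy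
    | smul a x hx hx' =>
      rw [nabla_smul]
      exact Submodule.add_mem _ (Submodule.smul_mem _ _ hx') (Submodule.smul_mem _ _ (hmono j hx))
  · intro G hG
    induction hG using Submodule.span_induction with
    | mem G hG =>
      obtain ⟨i, hi, rfl⟩ := hG
      rw [← hcomp _ (hshiftdeg _ (hvdeg i)), hshift, hkill i hi]
    | zero => simp
    | add x y _ _ hx hy => simp only [Pi.add_apply, mul_add, Finset.sum_add_distrib, hx, hy, add_zero]
    | smul a x _ hx =>
      simp only [Pi.smul_apply, smul_eq_mul, mul_left_comm _ a, ← Finset.mul_sum, hx, mul_zero]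

end RamanujanTriple

end Wronskian

/-- The exponents `(a, b, c)` of the monomials `E₂ ^ a * E₄ ^ b * E₆ ^ c` of weight `w` and
depth at most `r`. -/
def exponents (w r : ℕ) : Finset (ℕ × ℕ × ℕ) :=
  {i ∈ range (r + 1) ×ˢ range (w + 1) ×ˢ range (w + 1) | 2 * i.1 + 4 * i.2.1 + 6 * i.2.2 = w}

lemma mem_exponents {w r : ℕ} {i : ℕ × ℕ × ℕ} :
    i ∈ exponents w r ↔ i.1 ≤ r ∧ 2 * i.1 + 4 * i.2.1 + 6 * i.2.2 = w := by
  simp only [exponents, mem_filter, mem_product, mem_range]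
  omega

/-- The number of monomials `E₄ ^ b * E₆ ^ c` of weight `2 * (h - a)`, if `a ≤ h`. -/
def monomialCount (h a : ℕ) : ℕ := if a ≤ h then (h - a + 6 - 3 * ((h - a) % 2)) / 6 else 0

lemma sum_monomialCount_le_card (h r : ℕ) :
    ∑ a ∈ range (r + 1), monomialCount h a ≤ (exponents (2 * h) r).card := by
  have h1 : ∑ a ∈ range (r + 1), monomialCount h a =
      ((range (r + 1)).sigma fun a => range (monomialCount h a)).card := by simp
  rw [h1]
  refine Finset.card_le_card_of_injOn (fun x => (x.1, (h - x.1 - 3 * ((h - x.1) % 2 + 2 * x.2)) / 2,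
    (h - x.1) % 2 + 2 * x.2)) ?_ ?_
  · rintro ⟨a, i⟩ hx
    simp only [coe_sigma, Set.mem_sigma_iff, mem_coe, mem_range, monomialCount] at hx
    simp only [mem_coe, mem_exponents]
    split_ifs at hx <;> omega
  · rintro ⟨a, i⟩ _ ⟨a', i'⟩ _ hxy
    simp only [Prod.mk.injEq] at hxy
    obtain ⟨rfl, -, h3⟩ := hxy
    congr 1
    omega

lemma lt_twelve_mul_card {w r : ℕ} (hr : r ≤ 4) (hw : Even w) :
    (r + 1) * w < 12 * (exponents w r).card ∨ (r + 1) * w = 12 * (exponents w r).card + 2 := by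
  obtain ⟨h, rfl⟩ := hw.two_dvd
  have hsum := sum_monomialCount_le_card h r
  suffices H : (r + 1) * (2 * h) < 12 * ∑ a ∈ range (r + 1), monomialCount h a ∨
      (r + 1) * (2 * h) = 12 * (∑ a ∈ range (r + 1), monomialCount h a) + 2 by omega
  clear hsum
  rcases Nat.lt_or_ge h 4 with h4 | h4
  · interval_cases r <;> interval_cases h <;> simp_all [monomialCount, Finset.sum_range_succ]
  · obtain ⟨m, j, hj, rfl⟩ : ∃ m j, j < 6 ∧ h = 4 + j + 6 * m :=
      ⟨(h - 4) / 6, (h - 4) % 6, by omega, by omega⟩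
    have hcount : ∀ a ≤ 4, monomialCount (4 + j + 6 * m) a = monomialCount (4 + j) a + m := by
      intro a ha
      rw [monomialCount, monomialCount, if_pos (by omega), if_pos (by omega)]
      omega
    rw [Finset.sum_congr rfl fun a ha => hcount a (by have := Finset.mem_range.1 ha; omega),
      Finset.sum_add_distrib, Finset.sum_const, card_range, smul_eq_mul]
    have h1 : (r + 1) * (2 * (4 + j)) < 12 * ∑ a ∈ range (r + 1), monomialCount (4 + j) a ∨
        (r + 1) * (2 * (4 + j)) = 12 * (∑ a ∈ range (r + 1), monomialCount (4 + j) a) + 2 := by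
      clear hcount
      interval_cases r <;> interval_cases j <;> decide
    refine h1.imp (fun h => ?_) fun h => ?_ <;> linarith

namespace RamanujanTriple

variable {k : Type*} [Field k] (t : RamanujanTriple k)

/-- Linear independence of the monomials in `P`, `Q`, `R` modulo a power of `X`. -/
theorem eq_zero_of_X_pow_dvd_sum {p : ℕ} (hp : p.Prime) [CharP k p] {r w : ℕ} (hr : r ≤ 4)
    (hp5 : 5 ≤ p) (hw : w ≤ p) (c : ℕ × ℕ × ℕ → k)
    (hc : PowerSeries.X ^ (exponents w r).card ∣ ∑ i ∈ exponents w r,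
      PowerSeries.C (c i) * (t.P ^ i.1 * t.Q ^ i.2.1 * t.R ^ i.2.2)) :
    ∀ i ∈ exponents w r, c i = 0 := by
  intro i hi
  set f : QModRing k := ∑ i ∈ exponents w r,
    C (MvPolynomial.C (c i) * (vQ k ^ i.2.1 * vR k ^ i.2.2)) * X ^ i.1 with hf
  have hf0 : f = 0 := by
    refine eq_zero_of_X_pow_dvd_evA t hp (s := r) (w := w) (N := (exponents w r).card)
      (by omega) hw ?_ ?_ ?_ (lt_twelve_mul_card hr ?_)
    · refine Finset.sum_induction _ (fun g => (grA k).Hom w g) (fun _ _ => Grading.Hom.add)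
        (Grading.Hom.zero _) fun j hj => ?_
      have h1 := (Hom_C ((grB_C (c j)).mul ((grB_vQ.pow j.2.1).mul (grB_vR.pow j.2.2)))).mul
        (Hom_X.pow j.1)
      have h2 := (mem_exponents.1 hj).2
      convert h1 using 1
      omega
    · refine natDegree_sum_le_of_forall_le _ _ fun j hj => ?_
      exact (natDegree_C_mul_X_pow_le _ _).trans (mem_exponents.1 hj).1
    · rw [hf, map_sum]
      convert hc using 2 with j hj
      simp only [evA, coe_eval₂RingHom, eval₂_C, eval₂_X, map_mul, map_pow,
        evB_C, evB_vQ, evB_vR]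
      ring
    · have := (mem_exponents.1 hi).2
      exact ⟨i.1 + 2 * i.2.1 + 3 * i.2.2, by omega⟩
  have h1 : (f.coeff i.1).coeff (Finsupp.single 0 i.2.1 + Finsupp.single 1 i.2.2) = c i := by
    rw [hf, finsetSum_coeff, MvPolynomial.coeff_sum, Finset.sum_eq_single_of_mem i hi]
    · rw [coeff_C_mul_X_pow, if_pos rfl]
      simp [vQ, vR, MvPolynomial.X_pow_eq_monomial]
    · intro j hj hji
      rw [coeff_C_mul_X_pow]
      split_ifs with h
      · rw [vQ, vR, MvPolynomial.X_pow_eq_monomial, MvPolynomial.X_pow_eq_monomial,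
          MvPolynomial.monomial_mul, MvPolynomial.coeff_C_mul, MvPolynomial.coeff_monomial,
          if_neg, mul_zero]
        intro h'
        have hb := DFunLike.congr_fun h' 0
        have hc := DFunLike.congr_fun h' 1
        simp at hb hc
        exact hji (Prod.ext h.symm (Prod.ext hb hc))
      · simp
  rw [← h1, hf0]
  simp

end RamanujanTriple

end

noncomputable section

open scoped PowerSeries ModularForm Matrix
open Derivative

lemma qexp_eq_qParam (z : ℍ) : qexp z = Function.Periodic.qParam 1 z := by
  simp [qexp, Function.Periodic.qParam]

lemma norm_qexp (z : ℍ) : ‖qexp z‖ = Real.exp (-(2 * π * z.im)) := by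
  simp [qexp, Complex.norm_exp]

/-- `f` is given on all of `ℍ` by the convergent `q`-expansion `φ`. -/
def HasQ (f : ℍ → ℂ) (φ : ℂ⟦X⟧) : Prop :=
  ∀ z, HasSum (fun n => PowerSeries.coeff n φ * qexp z ^ n) (f z)

namespace HasQ

variable {f g : ℍ → ℂ} {φ ψ : ℂ⟦X⟧}

lemma add (hf : HasQ f φ) (hg : HasQ g ψ) : HasQ (f + g) (φ + ψ) := fun z => by
  simpa [add_mul] using (hf z).add (hg z)

lemma smul (hf : HasQ f φ) (c : ℂ) : HasQ (c • f) (c • φ) := fun z => by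
  simpa [mul_assoc] using (hf z).mul_left c

lemma sub (hf : HasQ f φ) (hg : HasQ g ψ) : HasQ (f - g) (φ - ψ) := fun z => by
  simpa [sub_mul] using (hf z).sub (hg z)

lemma zero : HasQ 0 0 := fun z => by simp [hasSum_zero]

lemma one : HasQ 1 1 := fun z => by
  have h := hasSum_ite_eq (α := ℂ) 0 1
  refine h.congr_fun fun n => ?_
  by_cases hn : n = 0 <;> simp [hn, PowerSeries.coeff_one]

lemma summable_norm (hf : HasQ f φ) (z : ℍ) :
    Summable fun n => ‖PowerSeries.coeff n φ * qexp z ^ n‖ := (hf z).summable.norm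

lemma mul (hf : HasQ f φ) (hg : HasQ g ψ) : HasQ (f * g) (φ * ψ) := fun z => by
  have h := tsum_mul_tsum_eq_tsum_sum_antidiagonal_of_summable_norm
    (hf.summable_norm z) (hg.summable_norm z)
  have hs := (summable_norm_sum_mul_antidiagonal_of_summable_norm
    (hf.summable_norm z) (hg.summable_norm z)).of_norm
  rw [(hf z).tsum_eq, (hg z).tsum_eq] at h
  rw [Pi.mul_apply, h]
  refine hs.hasSum.congr_fun fun n => ?_
  rw [PowerSeries.coeff_mul, Finset.sum_mul]
  refine Finset.sum_congr rfl fun i hi => ?_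
  have hn : i.1 + i.2 = n := by simpa using hi
  rw [← hn, pow_add]
  ring

lemma pow (hf : HasQ f φ) (n : ℕ) : HasQ (f ^ n) (φ ^ n) := by
  induction n with
  | zero => simpa using one
  | succ n ih => simpa [pow_succ] using ih.mul hf

lemma sum {ι : Type*} (s : Finset ι) {F : ι → ℍ → ℂ} {Φ : ι → ℂ⟦X⟧}
    (h : ∀ i ∈ s, HasQ (F i) (Φ i)) : HasQ (∑ i ∈ s, F i) (∑ i ∈ s, Φ i) := by
  classical
  induction s using Finset.induction_on with
  | empty => simpa using zero
  | insert i s hi ih =>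
    rw [Finset.sum_insert hi, Finset.sum_insert hi]
    exact (h i (by simp)).add (ih fun j hj => h j (by simp [hj]))

lemma eq_zero (h : HasQ 0 φ) : φ = 0 := by
  ext n
  have := ModularFormClass.qExpansion_coeff_unique (f := (0 : ModularForm 𝒮ℒ 0))
    (c := fun n => PowerSeries.coeff n φ) one_pos one_mem_strictPeriods_SL
    (fun z => by simpa [qexp_eq_qParam] using h z) n
  simpa [UpperHalfPlane.qExpansion_zero] using this

lemma unique (hf : HasQ f φ) (hg : HasQ f ψ) : φ = ψ := by
  have h := hf.sub hg
  rw [sub_self] at h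
  exact sub_eq_zero.mp h.eq_zero

lemma isBoundedAtImInfty (hf : HasQ f φ) : IsBoundedAtImInfty f :=
  isBoundedAtImInfty_of_hasSum_qExpansion (h := 1) one_pos fun z => by
    simpa [qexp_eq_qParam] using hf z

lemma ofModularForm {k : ℤ} (F : ModularForm 𝒮ℒ k) : HasQ F (qExpansion 1 F) := fun z => by
  rw [qexp_eq_qParam]
  exact ModularForm.hasSum_qExpansion F one_pos one_mem_strictPeriods_SL z

lemma norm_qexp_le {y : ℝ} {z : ℍ} (h : y ≤ z.im) : ‖qexp z‖ ≤ Real.exp (-(2 * π * y)) := by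
  rw [norm_qexp]
  gcongr

/-- Polynomial growth can be absorbed into the decay of `qⁿ`. -/
lemma summable_natCast_mul (hf : HasQ f φ) {y : ℝ} (hy : 0 < y) :
    Summable fun n : ℕ => (n : ℝ) * ‖PowerSeries.coeff n φ‖ * Real.exp (-(2 * π * y)) ^ n := by
  let z : ℍ := ⟨(y / 2 : ℝ) * Complex.I, by simpa using hy⟩
  have hz : ‖qexp z‖ = Real.exp (-(π * y)) := by
    rw [norm_qexp]
    congr 1
    simp [z, UpperHalfPlane.im]
    ring
  have hρ : Real.exp (-(π * y)) < 1 := by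
    rw [Real.exp_lt_one_iff]
    have := Real.pi_pos
    nlinarith [mul_pos this hy]
  have hlim := tendsto_self_mul_const_pow_of_lt_one (Real.exp_pos (-(π * y))).le hρ
  obtain ⟨C, hC⟩ := hlim.bddAbove_range
  refine Summable.of_nonneg_of_le (fun n => by positivity) (fun n => ?_)
    ((hf.summable_norm z).mul_left C)
  rw [norm_mul, norm_pow, hz]
  have h1 : (n : ℝ) * Real.exp (-(π * y)) ^ n ≤ C := hC ⟨n, rfl⟩
  have h2 : Real.exp (-(2 * π * y)) = Real.exp (-(π * y)) * Real.exp (-(π * y)) := by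
    rw [← Real.exp_add]
    congr 1
    ring
  rw [h2, mul_pow]
  calc _ = ((n : ℝ) * Real.exp (-(π * y)) ^ n) *
        (‖PowerSeries.coeff n φ‖ * Real.exp (-(π * y)) ^ n) := by ring
    _ ≤ _ := by gcongr

lemma hasDerivAt (hf : HasQ f φ) (z : ℍ) :
    HasDerivAt (f ∘ ofComplex)
      (∑' n : ℕ, 2 * π * Complex.I * (n * PowerSeries.coeff n φ * qexp z ^ n)) z := by
  let y := z.im / 2
  have hy : 0 < y := half_pos z.im_pos
  let t : Set ℂ := {w | y < w.im}
  have hto : IsOpen t := isOpen_lt continuous_const Complex.continuous_im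
  have hzt : (z : ℂ) ∈ t := half_lt_self z.im_pos
  have hpos : ∀ w ∈ t, 0 < w.im := fun w hw => hy.trans hw
  let e : ℂ → ℂ := fun w => Complex.exp (2 * π * Complex.I * w)
  have he : ∀ w, HasDerivAt e (2 * π * Complex.I * e w) w := fun w => by
    have := ((hasDerivAt_id w).const_mul (2 * π * Complex.I)).cexp
    simpa [e, mul_comm] using this
  have hd : HasDerivAt (fun w => ∑' n : ℕ, PowerSeries.coeff n φ * e w ^ n)
      (∑' n : ℕ, 2 * π * Complex.I * (n * PowerSeries.coeff n φ * e z ^ n)) z := by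
    refine hasDerivAt_tsum_of_isPreconnected (t := t) (y₀ := (z : ℂ))
      ((hf.summable_natCast_mul hy).mul_left (2 * π)) hto
      (convex_halfSpace_im_gt y).isPreconnected
      (g' := fun n w => 2 * π * Complex.I * (n * PowerSeries.coeff n φ * e w ^ n))
      ?_ ?_ hzt (hf z).summable hzt
    · intro n w _
      refine (((he w).pow n).const_mul (PowerSeries.coeff n φ)).congr_deriv ?_
      rcases n with _ | n
      · simp
      · simp only [Nat.add_sub_cancel, pow_succ]
        ring
    · intro n w hw
      have : ‖e w‖ ≤ Real.exp (-(2 * π * y)) :=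
        norm_qexp_le (z := ⟨w, hpos w hw⟩) hw.le
      simp only [norm_mul, norm_pow, Complex.norm_natCast, Complex.norm_I, Complex.norm_real,
        Real.norm_eq_abs, abs_of_pos Real.pi_pos, Complex.norm_ofNat, mul_one]
      gcongr
  refine hd.congr_of_eventuallyEq ?_
  filter_upwards [hto.mem_nhds hzt] with w hw
  have := (hf ⟨w, hpos w hw⟩).tsum_eq
  rw [Function.comp_apply, ofComplex_apply_of_im_pos (hpos w hw), ← this]
  rfl

lemma mdifferentiable (hf : HasQ f φ) : MDifferentiable 𝓘(ℂ) 𝓘(ℂ) f := fun z =>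
  UpperHalfPlane.mdifferentiableAt_iff.mpr (hf.hasDerivAt z).differentiableAt

lemma normalizedDeriv (hf : HasQ f φ) :
    HasQ (Derivative.normalizedDerivOfComplex f) (theta ℂ φ) := fun z => by
  have hs : Summable fun n : ℕ => (n : ℂ) * PowerSeries.coeff n φ * qexp z ^ n := by
    refine Summable.of_norm ?_
    simpa [norm_qexp] using hf.summable_natCast_mul z.im_pos
  rw [Derivative.normalizedDerivOfComplex, (hf.hasDerivAt z).deriv, tsum_mul_left,
    inv_mul_cancel_left₀ Complex.two_pi_I_ne_zero]
  simpa [coeff_theta] using hs.hasSum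

end HasQ

/-- The integral series `1 + c ∑_{n ≥ 1} σ_k(n) Xⁿ`. -/
def sigmaSeries (c : ℤ) (k : ℕ) : ℤ⟦X⟧ :=
  PowerSeries.mk fun n => if n = 0 then 1 else c * ArithmeticFunction.sigma k n

/-- The integral series of `E_2`. -/
def seriesP : ℤ⟦X⟧ := sigmaSeries (-24) 1

/-- The integral series of `E_4`. -/
def seriesQ : ℤ⟦X⟧ := sigmaSeries 240 3

/-- The integral series of `E_6`. -/
def seriesR : ℤ⟦X⟧ := sigmaSeries (-504) 5

lemma constantCoeff_sigmaSeries (c : ℤ) (k : ℕ) :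
    PowerSeries.constantCoeff (sigmaSeries c k) = 1 := by
  simp [sigmaSeries, ← PowerSeries.coeff_zero_eq_constantCoeff_apply]

lemma coeff_one_sigmaSeries (c : ℤ) (k : ℕ) :
    PowerSeries.coeff 1 (sigmaSeries c k) = c := by
  simp [sigmaSeries]

/-- Complexification of integral power series. -/
abbrev toC : ℤ⟦X⟧ →+* ℂ⟦X⟧ := PowerSeries.map (Int.castRingHom ℂ)

lemma constantCoeff_map_sigmaSeries {A : Type*} [CommRing A] (g : ℤ →+* A) (c : ℤ) (k : ℕ) :
    PowerSeries.constantCoeff (PowerSeries.map g (sigmaSeries c k)) = 1 := by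
  rw [← PowerSeries.coeff_zero_eq_constantCoeff_apply, PowerSeries.coeff_map,
    PowerSeries.coeff_zero_eq_constantCoeff_apply, constantCoeff_sigmaSeries, map_one]

lemma constantCoeff_toC_sigmaSeries (c : ℤ) (k : ℕ) :
    PowerSeries.constantCoeff (toC (sigmaSeries c k)) = 1 :=
  constantCoeff_map_sigmaSeries _ c k

lemma hasQ_Eis {k : ℕ} {c : ℤ} (hk : 1 ≤ k) (hc : (2 * k / ((bernoulli k : ℚ) : ℂ)) = -c) :
    HasQ (Eis k) (toC (sigmaSeries c (k - 1))) := fun z => by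
  have hS : Summable fun n : ℕ =>
      (ArithmeticFunction.sigma (k - 1) (n + 1) : ℂ) * qexp z ^ (n + 1) :=
    (summable_nat_add_iff 1).mpr (EisensteinSeries.summable_sigma_mul_cexp_pow (k := k) hk z)
  rw [← hasSum_nat_add_iff' 1]
  convert! (hS.mul_left (c : ℂ)).hasSum using 1
  · ext n
    simp [sigmaSeries, mul_assoc]
  · rw [Eis, hc, tsum_mul_left]
    simp [sigmaSeries]

lemma hasQ_Eis_two : HasQ (Eis 2) (toC seriesP) := hasQ_Eis (by norm_num) (by
  rw [bernoulli_two]; norm_num)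

lemma bernoulli_four : bernoulli 4 = -1 / 30 := by decide +kernel

lemma bernoulli_six : bernoulli 6 = 1 / 42 := by decide +kernel

lemma hasQ_Eis_four : HasQ (Eis 4) (toC seriesQ) := hasQ_Eis (by norm_num) (by
  rw [bernoulli_four]; norm_num)

lemma hasQ_Eis_six : HasQ (Eis 6) (toC seriesR) := hasQ_Eis (by norm_num) (by
  rw [bernoulli_six]; norm_num)

lemma Eis_two_eq : Eis 2 = EisensteinSeries.E2 := by
  ext z
  rw [Eis, EisensteinSeries.E2_eq_tsum_cexp, bernoulli_two]
  rw [tsum_pnat_eq_tsum_succ (f := fun n : ℕ => (ArithmeticFunction.sigma 1 n : ℂ) *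
    Complex.exp (2 * π * Complex.I * z) ^ n)]
  norm_num [qexp]

lemma Eis_eq_E {k : ℕ} (hk : 3 ≤ k) (hk2 : Even k) : Eis k = ModularForm.E hk := by
  ext z
  rw [Eis, EisensteinSeries.q_expansion_bernoulli hk hk2]
  simp only [zpow_natCast]
  rw [tsum_pnat_eq_tsum_succ (f := fun n : ℕ => (ArithmeticFunction.sigma (k - 1) n : ℂ) *
    Complex.exp (2 * π * Complex.I * z) ^ n)]
  simp [qexp]

lemma coe_top_eq_SL : ((⊤ : Subgroup SL(2, ℤ)) : Subgroup (GL (Fin 2) ℝ)) = 𝒮ℒ := by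
  simp [MonoidHom.range_eq_map]

lemma mem_Mset_iff {w : ℤ} {f : ℍ → ℂ} : f ∈ Mset w ↔ ∃ F : ModularForm 𝒮ℒ w, ⇑F = f :=
  ⟨fun ⟨F, hF⟩ => ⟨F.mcast rfl coe_top_eq_SL.symm, hF⟩,
    fun ⟨F, hF⟩ => ⟨F.mcast rfl coe_top_eq_SL, hF⟩⟩

lemma Eis_four_mem : Eis 4 ∈ Mset 4 :=
  mem_Mset_iff.mpr ⟨ModularForm.E (k := 4) (by norm_num), (Eis_eq_E _ (by decide)).symm⟩

lemma Eis_six_mem : Eis 6 ∈ Mset 6 :=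
  mem_Mset_iff.mpr ⟨ModularForm.E (k := 6) (by norm_num), (Eis_eq_E _ (by decide)).symm⟩

lemma mul_mem_Mset {v w : ℤ} {f g : ℍ → ℂ} (hf : f ∈ Mset v) (hg : g ∈ Mset w) :
    f * g ∈ Mset (v + w) := by
  rw [mem_Mset_iff] at *
  obtain ⟨F, rfl⟩ := hf
  obtain ⟨G, rfl⟩ := hg
  exact ⟨F.mul G, rfl⟩

lemma pow_mem_Mset {v : ℤ} {f : ℍ → ℂ} (hf : f ∈ Mset v) (n : ℕ) : f ^ n ∈ Mset (n * v) := by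
  induction n with
  | zero => exact mem_Mset_iff.mpr ⟨(1 : ModularForm 𝒮ℒ 0).mcast (by simp), by ext; simp⟩
  | succ n ih =>
    have := mul_mem_Mset ih hf
    rw [← pow_succ] at this
    convert this using 1
    push_cast
    ring_nf

lemma Eis_pow_mul_pow_mem (b c : ℕ) : Eis 4 ^ b * Eis 6 ^ c ∈ Mset ((4 * b + 6 * c : ℕ) : ℤ) := by
  have := mul_mem_Mset (pow_mem_Mset Eis_four_mem b) (pow_mem_Mset Eis_six_mem c)
  convert this using 1
  push_cast
  ring_nf

lemma mem_Mset_of_hasQ {w : ℤ} {f : ℍ → ℂ} {φ : ℂ⟦X⟧} (hf : HasQ f φ)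
    (h : ∀ γ : SL(2, ℤ), f ∣[w] γ = f) : f ∈ Mset w :=
  mem_Mset_iff.mpr ⟨{
    toFun := f
    slash_action_eq' := by
      rintro _ ⟨γ, rfl⟩
      exact h γ
    holo' := hf.mdifferentiable
    bdd_at_cusps' := fun {c} hc => by
      rw [Subgroup.IsArithmetic.isCusp_iff_isCusp_SL2Z] at hc
      rw [OnePoint.isBoundedAt_iff_forall_SL2Z hc]
      intro γ _
      rw [h]
      exact hf.isBoundedAtImInfty }, rfl⟩

/-- The weight-`w` monomials in `E_4` and `E_6`. -/
def modularMonomials (w : ℕ) : Set (ℍ → ℂ) :=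
  {f | ∃ b c : ℕ, 4 * b + 6 * c = w ∧ Eis 4 ^ b * Eis 6 ^ c = f}

lemma Disc_mul_mem_span {w : ℕ} {f : ℍ → ℂ}
    (hf : f ∈ Submodule.span ℂ (modularMonomials w)) :
    Disc * f ∈ Submodule.span ℂ (modularMonomials (w + 12)) := by
  induction hf using Submodule.span_induction with
  | zero => simp
  | add f g _ _ hf hg => rw [mul_add]; exact add_mem hf hg
  | smul a f _ hf => rw [mul_smul_comm]; exact Submodule.smul_mem _ a hf
  | mem f hf =>
    obtain ⟨b, c, h, rfl⟩ := hf
    have : Disc * (Eis 4 ^ b * Eis 6 ^ c) =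
        (1 / 1728 : ℂ) • (Eis 4 ^ (b + 3) * Eis 6 ^ c - Eis 4 ^ b * Eis 6 ^ (c + 2)) := by
      ext z
      simp [Disc]
      ring
    rw [this]
    refine Submodule.smul_mem _ _ (sub_mem ?_ ?_)
    · exact Submodule.subset_span ⟨b + 3, c, by omega, rfl⟩
    · exact Submodule.subset_span ⟨b, c + 2, by omega, rfl⟩

lemma exists_four_mul_add_six_mul {w : ℕ} (hw : Even w) (h : 4 ≤ w) :
    ∃ b c : ℕ, 4 * b + 6 * c = w := by
  obtain ⟨m, rfl⟩ := hw
  rcases Nat.even_or_odd' m with ⟨k, rfl | rfl⟩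
  · exact ⟨k, 0, by omega⟩
  · exact ⟨k - 1, 1, by omega⟩

/-- Modular forms are polynomials in `E_4` and `E_6`. -/
lemma mem_span_modularMonomials (w : ℕ) : ∀ f ∈ Mset w,
    f ∈ Submodule.span ℂ (modularMonomials w) := by
  induction w using Nat.strong_induction_on with
  | _ w ih =>
  intro f hf
  obtain ⟨F, rfl⟩ := mem_Mset_iff.mp hf
  rcases Nat.even_or_odd w with hw | hw
  swap
  · rw [ModularForm.levelOne_odd_weight_eq_zero (by exact_mod_cast hw) F]
    simp
  by_cases h4 : 4 ≤ w
  · obtain ⟨b, c, hbc⟩ := exists_four_mul_add_six_mul hw h4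
    have hG : HasQ (Eis 4 ^ b * Eis 6 ^ c) (toC (seriesQ ^ b * seriesR ^ c)) := by
      simpa using (hasQ_Eis_four.pow b).mul (hasQ_Eis_six.pow c)
    obtain ⟨G, hGf⟩ := mem_Mset_iff.mp (hbc ▸ Eis_pow_mul_pow_mem b c)
    let a := (qExpansion 1 F).coeff 0
    let H : ModularForm 𝒮ℒ (w : ℤ) := F - a • G
    have hH : (H : ℍ → ℂ) = F - a • (Eis 4 ^ b * Eis 6 ^ c) := by rw [← hGf]; rfl
    have h0 : (qExpansion 1 H).coeff 0 = 0 := by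
      have h1 := HasQ.ofModularForm H
      rw [hH] at h1
      rw [hH, h1.unique ((HasQ.ofModularForm F).sub (hG.smul a))]
      simp [a, constantCoeff_toC_sigmaSeries, seriesQ, seriesR]
    let K := CuspForm.discriminantEquiv (ModularForm.toCuspForm H h0)
    have hK : (F : ℍ → ℂ) = a • (Eis 4 ^ b * Eis 6 ^ c) + Disc * K := by
      ext z
      have h1 : ModularForm.discriminant z * K z = H z :=
        ModularForm.discriminant_mul_discriminantEquiv_apply (ModularForm.toCuspForm H h0) z
      have h2 : Disc z = ModularForm.discriminant z := by
        rw [ModularForm.discriminant_eq_E₄_cube_sub_E₆_sq, Disc,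
          Eis_eq_E (k := 4) (by norm_num) (by decide), Eis_eq_E (k := 6) (by norm_num) (by decide)]
      rw [Pi.add_apply, Pi.mul_apply, h2, h1, hH]
      simp
    rw [hK]
    refine add_mem (Submodule.smul_mem _ _ (Submodule.subset_span ⟨b, c, hbc, rfl⟩)) ?_
    by_cases h12 : 12 ≤ w
    · obtain ⟨v, rfl⟩ := Nat.exists_eq_add_of_le' h12
      refine Disc_mul_mem_span (ih v (by omega) _ ?_)
      exact mem_Mset_iff.mpr ⟨K.mcast (by simp), rfl⟩
    · rw [ModularFormClass.levelOne_neg_weight_eq_zero (by omega) K]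
      simp
  · obtain rfl | rfl : w = 0 ∨ w = 2 := by
      obtain ⟨m, rfl⟩ := hw
      omega
    · obtain ⟨a, ha⟩ := ModularFormClass.levelOne_weight_zero_const F
      rw [ha]
      have : Function.const ℍ a = a • (Eis 4 ^ 0 * Eis 6 ^ 0) := by ext; simp
      rw [this]
      exact Submodule.smul_mem _ _ (Submodule.subset_span ⟨0, 0, rfl, rfl⟩)
    · rw [rank_zero_iff_forall_zero.mp ModularForm.levelOne_weight_two_rank_zero F]
      simp

lemma eq_zero_of_mem_Mset_neg {w : ℤ} (hw : w < 0) {f : ℍ → ℂ} (hf : f ∈ Mset w) : f = 0 := by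
  obtain ⟨F, rfl⟩ := mem_Mset_iff.mp hf
  exact ModularFormClass.levelOne_neg_weight_eq_zero hw F

lemma hasDerivAt_D2 (γ : SL(2, ℤ)) (z : ℍ) :
    HasDerivAt (EisensteinSeries.D2 γ ∘ ofComplex)
      (-(2 * π * Complex.I) * (γ 1 0 / denom γ z) ^ 2) (z : ℂ) := by
  have h := (hasDerivAt_denom_zpow (γ : GL (Fin 2) ℝ) (-1) z).const_mul
    (2 * π * Complex.I * (γ 1 0 : ℂ))
  refine (h.congr_of_eventuallyEq ?_).congr_deriv ?_
  · filter_upwards [isOpen_upperHalfPlaneSet.mem_nhds z.im_pos] with w hw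
    simp [EisensteinSeries.D2, ofComplex_apply_of_im_pos hw, div_eq_mul_inv]
  · have hz := denom_ne_zero (γ : GL (Fin 2) ℝ) z
    rw [show ((-1 : ℤ) - 1) = -2 by norm_num, zpow_neg]
    simp
    field_simp

lemma serreDerivative_E2_slash (γ : SL(2, ℤ)) :
    serreDerivative 1 EisensteinSeries.E2 ∣[(4 : ℤ)] γ = serreDerivative 1 EisensteinSeries.E2 := by
  have hE : MDifferentiable 𝓘(ℂ) 𝓘(ℂ) EisensteinSeries.E2 := E2_mdifferentiable
  have hD : MDifferentiable 𝓘(ℂ) 𝓘(ℂ) (EisensteinSeries.D2 γ) := fun z =>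
    UpperHalfPlane.mdifferentiableAt_iff.mpr (hasDerivAt_D2 γ z).differentiableAt
  ext z
  have h1 := congrFun (normalizedDerivOfComplex_SL_slash (k := 2) hE (γ := γ)) z
  have h2 : (EisensteinSeries.E2 ∣[(2 : ℤ)] γ) = EisensteinSeries.E2 -
      (1 / (2 * riemannZeta 2)) • EisensteinSeries.D2 γ := EisensteinSeries.E2_slash_action γ
  have h3 : normalizedDerivOfComplex (EisensteinSeries.E2 ∣[(2 : ℤ)] γ) z =
      normalizedDerivOfComplex EisensteinSeries.E2 z - (1 / (2 * riemannZeta 2)) *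
        (-(γ 1 0 / denom γ z) ^ 2) := by
    rw [h2, normalizedDerivOfComplex_sub _ _ hE (hD.const_smul _),
      normalizedDerivOfComplex_smul _ _ hD]
    simp only [Pi.sub_apply, Pi.smul_apply, smul_eq_mul]
    rw [normalizedDerivOfComplex.eq_1 (EisensteinSeries.D2 γ), (hasDerivAt_D2 γ z).deriv]
    congr 2
    field_simp
  have h4 : (EisensteinSeries.E2 ∣[(2 : ℤ)] γ) z = EisensteinSeries.E2 z -
      (1 / (2 * riemannZeta 2)) * (2 * π * Complex.I * (γ 1 0 / denom γ z)) := by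
    rw [h2]; simp [EisensteinSeries.D2, mul_div_assoc]
  have h5 : (serreDerivative 1 EisensteinSeries.E2 ∣[(4 : ℤ)] γ) z =
      (normalizedDerivOfComplex EisensteinSeries.E2 ∣[(4 : ℤ)] γ) z -
        12⁻¹ * ((EisensteinSeries.E2 ∣[(2 : ℤ)] γ) z * (EisensteinSeries.E2 ∣[(2 : ℤ)] γ) z) := by
    have := congrFun (ModularForm.mul_slash_SL2 2 2 γ EisensteinSeries.E2 EisensteinSeries.E2) z
    grind [ModularForm.SL_slash_apply, serreDerivative_apply, Pi.mul_apply]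
  have h6 : (normalizedDerivOfComplex EisensteinSeries.E2 ∣[(4 : ℤ)] γ) z =
      normalizedDerivOfComplex (EisensteinSeries.E2 ∣[(2 : ℤ)] γ) z + 2 * (2 * π * Complex.I)⁻¹ *
        (γ 1 0 / denom γ z) * (EisensteinSeries.E2 ∣[(2 : ℤ)] γ) z := by
    rw [h1]
    simp
  have hπ : (π : ℂ) ≠ 0 := by exact_mod_cast Real.pi_ne_zero
  rw [h5, h6, h3, h4, serreDerivative_apply, riemannZeta_two]
  generalize (γ 1 0 : ℂ) / denom γ z = u
  field_simp
  linear_combination (24 * π * u * EisensteinSeries.E2 z - 72 * u ^ 2 * Complex.I) * Complex.I_sq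

/-- A function with a `q`-expansion, invariant of even weight `w`, and whose weight carries a
single monomial in `E_4` and `E_6`, is a multiple of that monomial. -/
lemma exists_eq_smul_of_hasQ {w b c : ℕ} {f : ℍ → ℂ} {φ : ℂ⟦X⟧} (hf : HasQ f φ)
    (h : ∀ γ : SL(2, ℤ), f ∣[(w : ℤ)] γ = f)
    (hw : ∀ b' c', 4 * b' + 6 * c' = w → b' = b ∧ c' = c) :
    φ = PowerSeries.constantCoeff φ • (toC seriesQ ^ b * toC seriesR ^ c) := by
  have h1 := mem_span_modularMonomials w f (mem_Mset_of_hasQ hf h)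
  have h2 : modularMonomials w ⊆ {Eis 4 ^ b * Eis 6 ^ c} := by
    rintro g ⟨b', c', hbc, rfl⟩
    obtain ⟨rfl, rfl⟩ := hw b' c' hbc
    rfl
  obtain ⟨a, rfl⟩ := Submodule.mem_span_singleton.mp (Submodule.span_mono h2 h1)
  have h3 := hf.unique (((hasQ_Eis_four.pow b).mul (hasQ_Eis_six.pow c)).smul a)
  have h4 : PowerSeries.constantCoeff φ = a := by
    rw [h3, PowerSeries.smul_eq_C_mul, map_mul, map_mul, map_pow, map_pow]
    simp only [seriesQ, seriesR, constantCoeff_toC_sigmaSeries]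
    simp
  rw [h4]
  exact h3

lemma hasQ_serreDerivative {k : ℂ} {f : ℍ → ℂ} {φ : ℂ⟦X⟧} (hf : HasQ f φ) :
    HasQ (serreDerivative k f) (theta ℂ φ - (k * 12⁻¹) • (toC seriesP * φ)) := by
  convert! hf.normalizedDeriv.sub ((hasQ_Eis_two.mul hf).smul (k * 12⁻¹)) using 1
  ext z
  simp [Eis_two_eq, mul_assoc]

lemma constantCoeff_serre {k : ℂ} {φ : ℂ⟦X⟧} (hφ : PowerSeries.constantCoeff φ = 1) :
    PowerSeries.constantCoeff (theta ℂ φ - (k * 12⁻¹) • (toC seriesP * φ)) = -(k * 12⁻¹) := by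
  have h0 : PowerSeries.constantCoeff (theta ℂ φ) = 0 := by
    rw [← PowerSeries.coeff_zero_eq_constantCoeff_apply, coeff_theta]
    simp
  rw [map_sub, h0, PowerSeries.smul_eq_C_mul, map_mul, map_mul _ (toC seriesP), hφ, seriesP,
    constantCoeff_toC_sigmaSeries]
  simp

lemma slash_eq_of_mem_Mset {w : ℤ} {f : ℍ → ℂ} (hf : f ∈ Mset w) (γ : SL(2, ℤ)) :
    f ∣[w] γ = f := by
  obtain ⟨F, rfl⟩ := mem_Mset_iff.mp hf
  exact F.slash_action_eq' _ ⟨γ, rfl⟩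

lemma theta_toC_seriesP :
    theta ℂ (toC seriesP) = (12⁻¹ : ℂ) • (toC seriesP * toC seriesP - toC seriesQ) := by
  have h := exists_eq_smul_of_hasQ (w := 4) (b := 1) (c := 0)
    (hasQ_serreDerivative (k := 1) hasQ_Eis_two)
    (by rw [Eis_two_eq]; exact serreDerivative_E2_slash) (by omega)
  rw [constantCoeff_serre (by exact constantCoeff_toC_sigmaSeries _ _)] at h
  rw [sub_eq_iff_eq_add] at h
  simp only [pow_one, pow_zero, one_mul, mul_one] at h
  rw [h]
  module

lemma theta_toC_seriesQ :
    theta ℂ (toC seriesQ) = (3⁻¹ : ℂ) • (toC seriesP * toC seriesQ - toC seriesR) := by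
  have h := exists_eq_smul_of_hasQ (w := 6) (b := 0) (c := 1)
    (hasQ_serreDerivative (k := (4 : ℤ)) hasQ_Eis_four)
    (fun γ => serreDerivative_slash_invariant hasQ_Eis_four.mdifferentiable
      (slash_eq_of_mem_Mset Eis_four_mem γ)) (by omega)
  rw [constantCoeff_serre (by exact constantCoeff_toC_sigmaSeries _ _)] at h
  rw [sub_eq_iff_eq_add] at h
  simp only [pow_one, pow_zero, one_mul] at h
  rw [h]
  push_cast
  module

lemma theta_toC_seriesR :
    theta ℂ (toC seriesR) = (2⁻¹ : ℂ) • (toC seriesP * toC seriesR - toC seriesQ ^ 2) := by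
  have h := exists_eq_smul_of_hasQ (w := 8) (b := 2) (c := 0)
    (hasQ_serreDerivative (k := (6 : ℤ)) hasQ_Eis_six)
    (fun γ => serreDerivative_slash_invariant hasQ_Eis_six.mdifferentiable
      (slash_eq_of_mem_Mset Eis_six_mem γ)) (by omega)
  rw [constantCoeff_serre (by exact constantCoeff_toC_sigmaSeries _ _)] at h
  rw [sub_eq_iff_eq_add] at h
  simp only [pow_zero, mul_one] at h
  rw [h]
  push_cast
  module

lemma theta_map {A B : Type*} [CommRing A] [CommRing B] (g : A →+* B) (φ : A⟦X⟧) :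
    theta B (PowerSeries.map g φ) = PowerSeries.map g (theta A φ) := by
  ext n
  simp [coeff_theta]

lemma toC_injective : Function.Injective toC :=
  PowerSeries.map_injective _ Int.cast_injective

lemma theta_seriesP : 12 * theta ℤ seriesP = seriesP ^ 2 - seriesQ := by
  apply toC_injective
  have h : (12 : ℂ⟦X⟧) * theta ℂ (toC seriesP) = toC seriesP ^ 2 - toC seriesQ := by
    rw [sq, theta_toC_seriesP, ← map_ofNat PowerSeries.C 12, ← PowerSeries.smul_eq_C_mul]
    module
  rw [map_mul, map_ofNat toC 12, ← theta_map, h]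
  simp

lemma theta_seriesQ : 3 * theta ℤ seriesQ = seriesP * seriesQ - seriesR := by
  apply toC_injective
  have h : (3 : ℂ⟦X⟧) * theta ℂ (toC seriesQ) = toC seriesP * toC seriesQ - toC seriesR := by
    rw [theta_toC_seriesQ, ← map_ofNat PowerSeries.C 3, ← PowerSeries.smul_eq_C_mul]
    module
  rw [map_mul, map_ofNat toC 3, ← theta_map, h]
  simp

lemma theta_seriesR : 2 * theta ℤ seriesR = seriesP * seriesR - seriesQ ^ 2 := by
  apply toC_injective
  have h : (2 : ℂ⟦X⟧) * theta ℂ (toC seriesR) = toC seriesP * toC seriesR - toC seriesQ ^ 2 := by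
    rw [theta_toC_seriesR, ← map_ofNat PowerSeries.C 2, ← PowerSeries.smul_eq_C_mul]
    module
  rw [map_mul, map_ofNat toC 2, ← theta_map, h]
  simp

lemma coeff_one_disc : PowerSeries.coeff 1 (seriesQ ^ 3 - seriesR ^ 2) = 1728 := by
  simp [pow_succ, PowerSeries.coeff_mul, Finset.Nat.antidiagonal_succ, seriesQ, seriesR,
    coeff_one_sigmaSeries, constantCoeff_sigmaSeries]

/-- The reductions of `E_2`, `E_4`, `E_6` modulo a prime `p ≥ 5`. -/
def zmodTriple (p : ℕ) [hp : Fact p.Prime] (h5 : 5 ≤ p) : RamanujanTriple (ZMod p) where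
  P := PowerSeries.map (Int.castRingHom (ZMod p)) seriesP
  Q := PowerSeries.map (Int.castRingHom (ZMod p)) seriesQ
  R := PowerSeries.map (Int.castRingHom (ZMod p)) seriesR
  constP := constantCoeff_map_sigmaSeries _ _ _
  constQ := constantCoeff_map_sigmaSeries _ _ _
  constR := constantCoeff_map_sigmaSeries _ _ _
  thetaP := by
    have h := congrArg (PowerSeries.map (Int.castRingHom (ZMod p))) theta_seriesP
    rw [map_mul, map_ofNat (PowerSeries.map (Int.castRingHom (ZMod p))) 12, ← theta_map] at h
    simpa using h
  thetaQ := by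
    have h := congrArg (PowerSeries.map (Int.castRingHom (ZMod p))) theta_seriesQ
    rw [map_mul, map_ofNat (PowerSeries.map (Int.castRingHom (ZMod p))) 3, ← theta_map] at h
    simpa using h
  thetaR := by
    have h := congrArg (PowerSeries.map (Int.castRingHom (ZMod p))) theta_seriesR
    rw [map_mul, map_ofNat (PowerSeries.map (Int.castRingHom (ZMod p))) 2, ← theta_map] at h
    simpa using h
  six_ne := fun h => by
    have h6 : p ∣ 2 * 3 := (ZMod.natCast_eq_zero_iff 6 p).mp (by exact_mod_cast h)
    rcases (Nat.Prime.dvd_mul hp.out).mp h6 with h | h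
    · exact absurd (Nat.le_of_dvd (by norm_num) h) (by omega)
    · exact absurd (Nat.le_of_dvd (by norm_num) h) (by omega)
  disc_ne := fun h => by
    rw [← map_pow, ← map_pow, ← map_sub, PowerSeries.coeff_map, coeff_one_disc] at h
    have h6 : p ∣ 2 ^ 6 * 3 ^ 3 := (ZMod.natCast_eq_zero_iff 1728 p).mp (by simpa using h)
    rcases (Nat.Prime.dvd_mul hp.out).mp h6 with h | h
    · exact absurd (Nat.le_of_dvd (by norm_num) (hp.out.dvd_of_dvd_pow h)) (by omega)
    · exact absurd (Nat.le_of_dvd (by norm_num) (hp.out.dvd_of_dvd_pow h)) (by omega)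

/-- The monomial `E_2^a E_4^b E_6^c`. -/
def monomialForm (i : ℕ × ℕ × ℕ) : ℍ → ℂ := Eis 2 ^ i.1 * Eis 4 ^ i.2.1 * Eis 6 ^ i.2.2

/-- The integral `q`-series of the monomial `E_2^a E_4^b E_6^c`. -/
def monomialSeries (i : ℕ × ℕ × ℕ) : ℤ⟦X⟧ := seriesP ^ i.1 * seriesQ ^ i.2.1 * seriesR ^ i.2.2

lemma hasQ_monomialForm (i : ℕ × ℕ × ℕ) : HasQ (monomialForm i) (toC (monomialSeries i)) := by
  simp only [monomialSeries, map_mul, map_pow]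
  exact ((hasQ_Eis_two.pow _).mul (hasQ_Eis_four.pow _)).mul (hasQ_Eis_six.pow _)

lemma constantCoeff_monomialSeries (i : ℕ × ℕ × ℕ) :
    PowerSeries.constantCoeff (monomialSeries i) = 1 := by
  simp [monomialSeries, seriesP, seriesQ, seriesR, constantCoeff_sigmaSeries]

lemma zero_mem_Mset (w : ℤ) : (0 : ℍ → ℂ) ∈ Mset w :=
  mem_Mset_iff.mpr ⟨0, rfl⟩

lemma QM_eq_bot {w : ℤ} (hw : w < 0) (r : ℕ) : QM w r = ⊥ := by
  rw [QM, Submodule.span_eq_bot]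
  rintro f ⟨h, hM, hf⟩
  ext z
  rw [hf z]
  refine Finset.sum_eq_zero fun l hl => ?_
  rw [eq_zero_of_mem_Mset_neg (by lia) (hM l (by simpa [Nat.lt_succ_iff] using hl))]
  simp

lemma QM_eq_span (w r : ℕ) :
    QM w r = Submodule.span ℂ (Set.range fun i : exponents w r => monomialForm i) := by
  apply le_antisymm
  · rw [QM, Submodule.span_le]
    rintro f ⟨h, hM, hf⟩
    have hf' : f = ∑ l ∈ Finset.range (r + 1), Eis 2 ^ l * h l := by
      ext z
      simp [hf z]
    rw [hf']
    refine Submodule.sum_mem _ fun l hl => ?_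
    have hl' : l ≤ r := by simpa [Nat.lt_succ_iff] using hl
    by_cases hlw : 2 * l ≤ w
    · have hm := hM l hl'
      rw [show (w : ℤ) - 2 * l = ((w - 2 * l : ℕ) : ℤ) by lia] at hm
      have hs := mem_span_modularMonomials _ _ hm
      generalize h l = g at hs
      induction hs using Submodule.span_induction with
      | mem g hg =>
        obtain ⟨b, c, hbc, rfl⟩ := hg
        refine Submodule.subset_span ⟨⟨(l, b, c), mem_exponents.mpr ⟨hl', ?_⟩⟩, ?_⟩
        · dsimp only
          omega
        · simp [monomialForm, mul_assoc]
      | zero => simp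
      | add x y _ _ hx hy => rw [mul_add]; exact add_mem hx hy
      | smul a x _ hx => rw [mul_smul_comm]; exact Submodule.smul_mem _ _ hx
    · rw [eq_zero_of_mem_Mset_neg (by lia) (hM l hl')]
      simp
  · rw [Submodule.span_le]
    rintro _ ⟨⟨⟨a, b, c⟩, hi⟩, rfl⟩
    obtain ⟨ha, hw⟩ := mem_exponents.mp hi
    dsimp only at ha hw
    refine Submodule.subset_span ⟨fun l => if l = a then Eis 4 ^ b * Eis 6 ^ c else 0, ?_, ?_⟩
    · intro l hl
      dsimp only
      split_ifs with h
      · have := Eis_pow_mul_pow_mem b c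
        rwa [show (((4 * b + 6 * c : ℕ) : ℤ)) = (w : ℤ) - 2 * l by lia] at this
      · exact zero_mem_Mset _
    · intro z
      rw [Finset.sum_eq_single a]
      · simp [monomialForm, mul_assoc]
      · intro l _ hl
        simp [hl]
      · intro h
        exact absurd (Finset.mem_range.mpr (by omega)) h

/-- The matrix of the first `dim QM_w^r` Fourier coefficients of the monomials spanning
`QM_w^r`. -/
def coeffMatrix (w r : ℕ) : Matrix (exponents w r) (exponents w r) ℤ :=
  Matrix.of fun i j => PowerSeries.coeff ((exponents w r).equivFin j) (monomialSeries i)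

lemma vecMul_map_coeffMatrix {A : Type*} [CommRing A] {w r : ℕ} (g : ℤ →+* A)
    (v : exponents w r → A) (j : exponents w r) :
    (v ᵥ* g.mapMatrix (coeffMatrix w r)) j =
      PowerSeries.coeff ((exponents w r).equivFin j)
        (∑ i, v i • PowerSeries.map g (monomialSeries i)) := by
  simp [Matrix.vecMul, dotProduct, coeffMatrix]

lemma not_dvd_det_of_five_le {w r p : ℕ} (hr : r ≤ 4) (hp : p.Prime) (h5 : 5 ≤ p) (hw : w ≤ p) :
    ¬ (p : ℤ) ∣ (coeffMatrix w r).det := by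
  intro hdvd
  have : Fact p.Prime := ⟨hp⟩
  have hdet : ((Int.castRingHom (ZMod p)).mapMatrix (coeffMatrix w r)).det = 0 := by
    rw [← RingHom.map_det]
    exact (ZMod.intCast_zmod_eq_zero_iff_dvd _ p).mpr hdvd
  obtain ⟨v, hv0, hv⟩ := Matrix.exists_vecMul_eq_zero_iff.mpr hdet
  let c : ℕ × ℕ × ℕ → ZMod p := fun i => if h : i ∈ exponents w r then v ⟨i, h⟩ else 0
  have hsum : ∑ i ∈ exponents w r, PowerSeries.C (c i) * ((zmodTriple p h5).P ^ i.1 *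
      (zmodTriple p h5).Q ^ i.2.1 * (zmodTriple p h5).R ^ i.2.2) =
      ∑ i, v i • PowerSeries.map (Int.castRingHom (ZMod p)) (monomialSeries i) := by
    rw [← Finset.sum_coe_sort]
    refine Finset.sum_congr rfl fun i _ => ?_
    rw [PowerSeries.smul_eq_C_mul]
    simp [c, monomialSeries, zmodTriple]
  have hc := (zmodTriple p h5).eq_zero_of_X_pow_dvd_sum hp hr h5 hw c (by
    rw [hsum, PowerSeries.X_pow_dvd_iff]
    intro m hm
    have h := congrFun hv ((exponents w r).equivFin.symm ⟨m, hm⟩)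
    rw [vecMul_map_coeffMatrix] at h
    simpa using h)
  apply hv0
  ext i
  simpa [c] using hc i i.2

lemma not_dvd_det {w r p : ℕ} (hr : r ≤ 4) (hp : p.Prime) (hw : w ≤ p) :
    ¬ (p : ℤ) ∣ (coeffMatrix w r).det := by
  by_cases h5 : 5 ≤ p
  · exact not_dvd_det_of_five_le hr hp h5 hw
  have hp4 : p ≠ 4 := by rintro rfl; revert hp; decide
  have hS : Subsingleton (exponents w r) := ⟨by
    rintro ⟨⟨a, b, c⟩, hi⟩ ⟨⟨a', b', c'⟩, hi'⟩
    have h := (mem_exponents.mp hi).2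
    have h' := (mem_exponents.mp hi').2
    dsimp only at h h'
    simp only [Subtype.mk.injEq, Prod.mk.injEq]
    omega⟩
  have hdet : (coeffMatrix w r).det = 1 := by
    rcases isEmpty_or_nonempty (exponents w r) with hE | ⟨⟨i⟩⟩
    · exact Matrix.det_isEmpty
    · rw [Matrix.det_eq_elem_of_subsingleton _ i]
      have hN : (exponents w r).card ≤ 1 := by
        simpa using Fintype.card_le_one_iff_subsingleton.mpr hS
      have h0 : ((exponents w r).equivFin i : ℕ) = 0 := by
        have := ((exponents w r).equivFin i).2
        omega
      simp [coeffMatrix, h0, constantCoeff_monomialSeries]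
  rw [hdet]
  intro h
  exact hp.one_lt.not_ge (Nat.le_of_dvd one_pos (by exact_mod_cast h))

lemma det_coeffMatrix_ne_zero {w r : ℕ} (hr : r ≤ 4) : (coeffMatrix w r).det ≠ 0 := by
  intro h
  obtain ⟨p, hwp, hp⟩ := Nat.exists_infinite_primes w
  exact not_dvd_det hr hp hwp (h ▸ dvd_zero _)

lemma hasQ_sum_monomialForm {w r : ℕ} (c : exponents w r → ℂ) :
    HasQ (∑ i, c i • monomialForm i) (∑ i, c i • toC (monomialSeries i)) :=
  HasQ.sum _ fun i _ => (hasQ_monomialForm i).smul (c i)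

lemma linearIndependent_monomialForm {w r : ℕ} (hr : r ≤ 4) :
    LinearIndependent ℂ fun i : exponents w r => monomialForm i := by
  rw [Fintype.linearIndependent_iff]
  intro c hc
  have h0 := HasQ.eq_zero (hc ▸ hasQ_sum_monomialForm c)
  refine congrFun (Matrix.eq_zero_of_vecMul_eq_zero
    (M := (Int.castRingHom ℂ).mapMatrix (coeffMatrix w r)) ?_ ?_)
  · rw [← RingHom.map_det]
    simpa using det_coeffMatrix_ne_zero hr
  · ext j
    rw [vecMul_map_coeffMatrix, h0]
    simp

lemma dimQM_eq_card {w r : ℕ} (hr : r ≤ 4) : dimQM w r = (exponents w r).card := by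
  rw [dimQM, QM_eq_span, finrank_span_eq_card (linearIndependent_monomialForm hr)]
  simp

lemma hasQ_of_hasSum_shift {f : ℍ → ℂ} {a : ℕ → ℂ} {k : ℕ}
    (h : ∀ z : ℍ, HasSum (fun n : ℕ => a n * qexp z ^ (k + n)) (f z)) :
    HasQ f (PowerSeries.X ^ k * PowerSeries.mk a) := fun z => by
  rw [← hasSum_nat_add_iff' k, Finset.sum_eq_zero, sub_zero]
  · simpa [PowerSeries.coeff_X_pow_mul, add_comm k] using h z
  · intro n hn
    simp [PowerSeries.coeff_X_pow_mul', (Finset.mem_range.mp hn).not_ge]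

/-- If the first `dim QM_w^r` coefficients of a form in `QM_w^r` are integers, then
`det * f` is an integral combination of the monomials. -/
lemma exists_int_det_mul {w r : ℕ} {c : exponents w r → ℂ} {b : exponents w r → ℤ}
    (h : c ᵥ* (Int.castRingHom ℂ).mapMatrix (coeffMatrix w r) = fun j => (b j : ℂ)) :
    ∃ d : exponents w r → ℤ, ∀ i, ((coeffMatrix w r).det : ℂ) * c i = d i := by
  refine ⟨b ᵥ* (coeffMatrix w r).adjugate, fun i => ?_⟩
  have h1 := congrArg (fun v => v ᵥ* ((Int.castRingHom ℂ).mapMatrix (coeffMatrix w r)).adjugate) h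
  simp only [Matrix.vecMul_vecMul, Matrix.mul_adjugate, ← RingHom.map_det,
    Matrix.vecMul_smul, Matrix.vecMul_one] at h1
  have h2 := congrFun h1 i
  rw [← RingHom.map_adjugate] at h2
  simpa [Matrix.vecMul, dotProduct] using h2

lemma exists_int_det_mul_coeff {w r : ℕ} (hr : r ≤ 4) {f : ℍ → ℂ} (hf : f ∈ QM w r) {a : ℕ → ℂ}
    (ha0 : a 0 = 1)
    (ha : ∀ z : ℍ, HasSum (fun n : ℕ => a n * qexp z ^ (dimQM w r - 1 + n)) (f z)) (n : ℕ) :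
    ∃ m : ℤ, ((coeffMatrix w r).det : ℂ) * a n = m := by
  rw [QM_eq_span] at hf
  obtain ⟨c, rfl⟩ := (Submodule.mem_span_range_iff_exists_fun ℂ).mp hf
  have hφ := (hasQ_sum_monomialForm c).unique (hasQ_of_hasSum_shift ha)
  rw [dimQM_eq_card hr] at hφ
  obtain ⟨d, hd⟩ := exists_int_det_mul (c := c)
    (b := fun j => if ((exponents w r).equivFin j : ℕ) = (exponents w r).card - 1 then 1 else 0) (by
      ext j
      rw [vecMul_map_coeffMatrix, hφ, PowerSeries.coeff_X_pow_mul']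
      have hj := ((exponents w r).equivFin j).2
      split_ifs with h1 h2 h2
      · simp [h2, ha0]
      · omega
      · omega
      · simp)
  refine ⟨∑ i, d i * PowerSeries.coeff ((exponents w r).card - 1 + n) (monomialSeries i), ?_⟩
  have han := congrArg (PowerSeries.coeff ((exponents w r).card - 1 + n)) hφ
  rw [add_comm, PowerSeries.coeff_X_pow_mul, PowerSeries.coeff_mk, add_comm] at han
  rw [← han, map_sum, Finset.mul_sum, Int.cast_sum]
  refine Finset.sum_congr rfl fun i _ => ?_
  rw [Int.cast_mul, ← hd i, map_smul, smul_eq_mul, PowerSeries.coeff_map, eq_intCast, mul_assoc]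

end

end ExtremalQM

open ExtremalQM in
/-- Theorem 6 of the paper, conjectured by Kaneko and Koike: the
Fourier coefficients of a normalized extremal quasimodular form of weight `w` and depth
`r ≤ 4` are rational numbers whose denominators are divisible only by primes `p < w`. -/
theorem kaneko_koike_denominators (w : ℤ) (r : ℕ) (hr : r ≤ 4)
    (f : ℍ → ℂ) (hf : f ∈ QM w r) (a : ℕ → ℂ) (ha0 : a 0 = 1)
    (ha : ∀ z : ℍ, HasSum (fun n : ℕ => a n * qexp z ^ (dimQM w r - 1 + n)) (f z)) :
    ∀ n : ℕ, ∃ c : ℚ, a n = (c : ℂ) ∧ ∀ p : ℕ, p.Prime → p ∣ c.den → (p : ℤ) < w := by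
  intro n
  rcases lt_or_ge w 0 with hw | hw
  · rw [QM_eq_bot hw, Submodule.mem_bot] at hf
    subst hf
    have h := congrArg (PowerSeries.coeff (dimQM w r - 1)) (hasQ_of_hasSum_shift ha).eq_zero
    simp [PowerSeries.coeff_X_pow_mul', ha0] at h
  lift w to ℕ using hw
  obtain ⟨m, hm⟩ := exists_int_det_mul_coeff hr hf ha0 ha n
  have hdet := det_coeffMatrix_ne_zero (w := w) hr
  refine ⟨Rat.divInt m (coeffMatrix w r).det, ?_, fun p hp hpd => ?_⟩
  · have hdet' : ((coeffMatrix w r).det : ℂ) ≠ 0 := Int.cast_ne_zero.mpr hdet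
    rw [Rat.divInt_eq_div, Rat.cast_div, Rat.cast_intCast, Rat.cast_intCast, ← hm,
      mul_div_cancel_left₀ _ hdet']
  · by_contra hlt
    refine not_dvd_det (w := w) (r := r) hr hp (by lia) ?_
    exact (Int.natCast_dvd_natCast.mpr hpd).trans (Rat.den_dvd _ _)
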